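/- arXiv:2206.12499 — 3 statements merged into one kernel-verified Lean document; each statement's English description precedes it below -/
import Mathlib

section
/- Let k, ℓ ≥ 3 and let s^(c)_n(k,ℓ) denote the number of (k,ℓ)-right-crucial permutations of length n. Then for every n with k+ℓ−3 ≤ n < (k−1)(ℓ−1), we have s^(c)_n(k,ℓ) < s^(c)_{n+1}(k,ℓ). -/
/-- `σ` (in one-line notation, 0-based) has an increasing subsequence of length `k`,
i.e. contains an occurrence of the pattern `i_k`. -/
def HasIncr (k n : ℕ) (σ : Fin n → Fin n) : Prop :=
  ∃ f : Fin k → Fin n, StrictMono f ∧ StrictMono (σ ∘ f)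

/-- `σ` has a decreasing subsequence of length `l`,
i.e. contains an occurrence of the pattern `d_l`. -/
def HasDecr (l n : ℕ) (σ : Fin n → Fin n) : Prop :=
  ∃ f : Fin l → Fin n, StrictMono f ∧ StrictAnti (σ ∘ f)

/-- `σ` contains `i_k` or `d_l`. -/
def ContainsPat (k l n : ℕ) (σ : Fin n → Fin n) : Prop :=
  HasIncr k n σ ∨ HasDecr l n σ

/-- `σ` avoids both `i_k` and `d_l`. -/
def AvoidsPat (k l n : ℕ) (σ : Fin n → Fin n) : Prop :=
  ¬ HasIncr k n σ ∧ ¬ HasDecr l n σ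

/-- The `i`-th extension of `σ` to the right (0-based): append the value `i` at the end,
renaming old values via `Fin.succAbove i` (i.e. `x ↦ x` if `x < i`, `x ↦ x+1` if `x ≥ i`). -/
def rightExt {n : ℕ} (σ : Fin n → Fin n) (i : Fin (n + 1)) : Fin (n + 1) → Fin (n + 1) :=
  Fin.snoc (fun j => i.succAbove (σ j)) i

/-- The `i`-th extension of `σ` to the left: prepend the value `i`. -/
def leftExt {n : ℕ} (σ : Fin n → Fin n) (i : Fin (n + 1)) : Fin (n + 1) → Fin (n + 1) :=
  Fin.cons i (fun j => i.succAbove (σ j))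

/-- The `i`-th extension of `σ` from above: insert the new maximum value at position `i`. -/
def topExt {n : ℕ} (σ : Fin n → Fin n) (i : Fin (n + 1)) : Fin (n + 1) → Fin (n + 1) :=
  i.insertNth (Fin.last n) (fun j => (σ j).castSucc)

/-- The `i`-th extension of `σ` from below: insert the new minimum value at position `i`,
increasing all old values by one. -/
def botExt {n : ℕ} (σ : Fin n → Fin n) (i : Fin (n + 1)) : Fin (n + 1) → Fin (n + 1) :=
  i.insertNth 0 (fun j => (σ j).succ)

/-- `σ` is `(k,l)`-right-crucial (also called `(k,l)`-crucial): it avoids `i_k` and `d_l`,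
but every extension of it to the right contains `i_k` or `d_l`. -/
def RightCrucial (k l n : ℕ) (σ : Fin n → Fin n) : Prop :=
  AvoidsPat k l n σ ∧ ∀ i : Fin (n + 1), ContainsPat k l (n + 1) (rightExt σ i)

/-- `σ` is `(k,l)`-left-crucial. -/
def LeftCrucial (k l n : ℕ) (σ : Fin n → Fin n) : Prop :=
  AvoidsPat k l n σ ∧ ∀ i : Fin (n + 1), ContainsPat k l (n + 1) (leftExt σ i)

/-- `σ` is `(k,l)`-top-crucial. -/
def TopCrucial (k l n : ℕ) (σ : Fin n → Fin n) : Prop :=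
  AvoidsPat k l n σ ∧ ∀ i : Fin (n + 1), ContainsPat k l (n + 1) (topExt σ i)

/-- `σ` is `(k,l)`-bottom-crucial. -/
def BottomCrucial (k l n : ℕ) (σ : Fin n → Fin n) : Prop :=
  AvoidsPat k l n σ ∧ ∀ i : Fin (n + 1), ContainsPat k l (n + 1) (botExt σ i)

/-- `σ` is `(k,l)`-bicrucial: both right-crucial and left-crucial. -/
def Bicrucial (k l n : ℕ) (σ : Fin n → Fin n) : Prop :=
  RightCrucial k l n σ ∧ LeftCrucial k l n σ

/-- `σ` is `(k,l)`-top-right-crucial: right-crucial and every extension from above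
contains `i_k` or `d_l`. -/
def TopRightCrucial (k l n : ℕ) (σ : Fin n → Fin n) : Prop :=
  RightCrucial k l n σ ∧ ∀ i : Fin (n + 1), ContainsPat k l (n + 1) (topExt σ i)

/-- `σ` is `(k,l)`-tricrucial: bicrucial and every extension from above
contains `i_k` or `d_l`. -/
def Tricrucial (k l n : ℕ) (σ : Fin n → Fin n) : Prop :=
  Bicrucial k l n σ ∧ ∀ i : Fin (n + 1), ContainsPat k l (n + 1) (topExt σ i)

/-- `σ` is `(k,l)`-quadrocrucial: tricrucial and every extension from below
contains `i_k` or `d_l`. -/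
def Quadrocrucial (k l n : ℕ) (σ : Fin n → Fin n) : Prop :=
  Tricrucial k l n σ ∧ ∀ i : Fin (n + 1), ContainsPat k l (n + 1) (botExt σ i)

namespace CrucialAux

def vc (h : ℕ → ℕ) (y : ℕ) : ℕ → ℕ
  | 0 => 0
  | j+1 => if h j = vc h y j ∧ (h j ≠ 0 ∨ j = y) then vc h y j + 1 else vc h y j

def hs (h : ℕ → ℕ) (y : ℕ) (j : ℕ) : ℕ :=
  if h j = vc h y j ∧ (h j ≠ 0 ∨ j = y) then h j + 1 else h j

def Hf (f : ℕ → ℕ) : ℕ → ℕ → ℕ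
  | 0 => fun _ => 0
  | i+1 => hs (Hf f i) (f i)

def Vf (f : ℕ → ℕ) (i j : ℕ) : ℕ := vc (Hf f i) (f i) j

def cnt (h : ℕ → ℕ) (r : ℕ) : ℕ → ℕ
  | 0 => 0
  | j+1 => cnt h r j + if h j = r then 1 else 0

def Part (h : ℕ → ℕ) (j : ℕ) : Prop := ∀ r, 1 ≤ r → cnt h (r+1) j ≤ cnt h r j

lemma cnt_congr {h g : ℕ → ℕ} {r j : ℕ} (H : ∀ i < j, h i = g i) : cnt h r j = cnt g r j := by
  induction j with
  | zero => rfl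
  | succ j ih =>
    simp only [cnt]
    rw [ih (fun i hi => H i (by omega)), H j (by omega)]

lemma cnt_zero {h : ℕ → ℕ} {r j : ℕ} (H : ∀ i < j, h i = 0) (hr : 1 ≤ r) : cnt h r j = 0 := by
  induction j with
  | zero => rfl
  | succ j ih =>
    have e : ¬ h j = r := by rw [H j (by omega)]; omega
    simp only [cnt]
    rw [ih (fun i hi => H i (by omega)), if_neg e]

lemma cnt_mono (h : ℕ → ℕ) (r : ℕ) : Monotone (cnt h r) :=
  monotone_nat_of_le_succ (fun j => by simp [cnt])

lemma vc_congr {h g : ℕ → ℕ} {y j : ℕ} (H : ∀ i < j, h i = g i) : vc h y j = vc g y j := by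
  induction j with
  | zero => rfl
  | succ j ih =>
    simp only [vc]
    rw [ih (fun i hi => H i (by omega)), H j (by omega)]

lemma hs_congr {h g : ℕ → ℕ} {y j : ℕ} (H : ∀ i ≤ j, h i = g i) : hs h y j = hs g y j := by
  simp only [hs]
  rw [vc_congr (fun i hi => H i (by omega)), H j le_rfl]

lemma vc_zero (h : ℕ → ℕ) (y j : ℕ) (hj : j ≤ y) : vc h y j = 0 := by
  induction j with
  | zero => rfl
  | succ j ih =>
    have := ih (by omega)
    simp only [vc, this]
    rw [if_neg (by omega)]

lemma vc_mono (h : ℕ → ℕ) (y : ℕ) : Monotone (vc h y) :=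
  monotone_nat_of_le_succ (fun j => by simp only [vc]; split_ifs <;> omega)

lemma vc_pos (h : ℕ → ℕ) (y j : ℕ) (hy : h y = 0) (hj : y < j) : 1 ≤ vc h y j := by
  have h1 : 1 ≤ vc h y (y+1) := by
    simp only [vc, vc_zero h y y le_rfl, hy]; simp
  exact h1.trans (vc_mono h y hj)

lemma path (h : ℕ → ℕ) (y r j : ℕ) (hr : 1 ≤ r) :
    cnt (hs h y) r j = cnt h r j + if vc h y j = r then 1 else 0 := by
  induction j with
  | zero =>
    have : (0:ℕ) ≠ r := by omega
    simp [cnt, vc, this]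
  | succ j ih =>
    simp only [cnt, ih, hs, vc]
    split_ifs <;> omega

lemma part_hs (h : ℕ → ℕ) (y : ℕ) (H : ∀ j, Part h j) (j : ℕ) : Part (hs h y) j := by
  induction j with
  | zero => intro r hr; simp [cnt]
  | succ j ih =>
    intro r hr
    have h0 := H j r hr
    have h1 := H (j+1) r hr
    have h2 := ih r hr
    rw [path _ _ _ _ hr, path _ _ _ _ (by omega)] at h2 ⊢
    simp only [cnt, vc] at *
    split_ifs at * <;> omega

lemma part_Hf (f : ℕ → ℕ) (i j : ℕ) : Part (Hf f i) j := by
  induction i generalizing j with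
  | zero =>
    intro r hr
    rw [cnt_zero (h := Hf f 0) (fun _ _ => rfl) (by omega), cnt_zero (h := Hf f 0) (fun _ _ => rfl) hr]
  | succ i ih => exact part_hs _ _ ih j

lemma content (f : ℕ → ℕ) (r i j : ℕ) (hr : 1 ≤ r) :
    cnt (Hf f i) r j = cnt (fun i => Vf f i j) r i := by
  induction i with
  | zero =>
    rw [cnt_zero (h := Hf f 0) (fun _ _ => rfl) hr]; rfl
  | succ i ih =>
    simp only [Hf]
    rw [path _ _ _ _ hr, ih]
    rfl

lemma Hf_congr {f g : ℕ → ℕ} {m : ℕ} (H : ∀ i < m, f i = g i) : Hf f m = Hf g m := by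
  induction m with
  | zero => rfl
  | succ m ih =>
    simp only [Hf]
    rw [ih (fun i hi => H i (by omega)), H m (by omega)]

lemma Vf_congr {f g : ℕ → ℕ} {m j : ℕ} (H : ∀ i ≤ m, f i = g i) : Vf f m j = Vf g m j := by
  simp only [Vf]
  rw [Hf_congr (fun i hi => H i (by omega)), H m le_rfl]

lemma hs_ne_zero (h : ℕ → ℕ) (y j : ℕ) : hs h y j ≠ 0 ↔ h j ≠ 0 ∨ j = y := by
  simp only [hs]
  by_cases hj : j = y
  · subst hj
    rw [vc_zero h j j le_rfl]
    split_ifs <;> simp_all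
  · simp only [hj, or_false]
    split_ifs <;> omega

lemma Hf_ne_zero (f : ℕ → ℕ) (i j : ℕ) : Hf f i j ≠ 0 ↔ ∃ p < i, f p = j := by
  induction i with
  | zero => simp [Hf]
  | succ i ih =>
    simp only [Hf]
    rw [hs_ne_zero, ih]
    constructor
    · rintro (⟨p, hp, h⟩ | h)
      · exact ⟨p, by omega, h⟩
      · exact ⟨i, by omega, h.symm⟩
    · rintro ⟨p, hp, h⟩
      by_cases hpi : p = i
      · right; rw [← h, hpi]
      · left; exact ⟨p, by omega, h⟩

lemma Hf_diag {f : ℕ → ℕ} (hf : Function.Injective f) (i : ℕ) : Hf f i (f i) = 0 := by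
  by_contra h
  obtain ⟨p, hp, e⟩ := (Hf_ne_zero f i (f i)).1 h
  have := hf e
  omega

lemma hs_le (h : ℕ → ℕ) (y j : ℕ) : h j ≤ hs h y j := by
  simp only [hs]; split_ifs <;> omega

lemma Hf_mono (f : ℕ → ℕ) (j : ℕ) : Monotone (fun i => Hf f i j) :=
  monotone_nat_of_le_succ (fun _ => hs_le _ _ _)

/-! Increasing chains -/

def Inc (f : ℕ → ℕ) : ℕ → ℕ → ℕ → Prop
  | 0, _, _ => True
  | k+1, i, j => ∃ p < i, f p < j ∧ Inc f k p (f p)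

lemma Inc_mono {f : ℕ → ℕ} {k i j i' j' : ℕ} (h : Inc f k i j) (hi : i ≤ i') (hj : j ≤ j') :
    Inc f k i' j' := by
  cases k with
  | zero => trivial
  | succ k =>
    obtain ⟨p, hp, h1, h2⟩ := h
    exact ⟨p, by omega, by omega, h2⟩

lemma Lmono (f : ℕ → ℕ) (r : ℕ) (hr : 1 ≤ r) {i i' j j' : ℕ} (hi : i ≤ i') (hj : j ≤ j') :
    cnt (Hf f i) r j ≤ cnt (Hf f i') r j' := by
  refine le_trans ?_ (cnt_mono _ _ hj)
  rw [content _ _ _ _ hr, content _ _ _ _ hr]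
  exact cnt_mono _ _ hi

lemma inc_le {f : ℕ → ℕ} (hf : Function.Injective f) {k i j : ℕ} (h : Inc f k i j) :
    k ≤ cnt (Hf f i) 1 j := by
  induction k generalizing i j with
  | zero => omega
  | succ k ih =>
    obtain ⟨p, hp, h1, h2⟩ := h
    have h3 := ih h2
    refine le_trans ?_ (Lmono f 1 le_rfl (i := p+1) (j := f p + 1) hp h1)
    simp only [Hf]
    rw [path _ _ _ _ le_rfl]
    have e : vc (Hf f p) (f p) (f p + 1) = 1 := by
      simp [vc, vc_zero _ _ _ le_rfl, Hf_diag hf]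
    simp only [cnt, e, if_true]
    omega

lemma le_inc (f : ℕ → ℕ) (i j : ℕ) : Inc f (cnt (Hf f i) 1 j) i j := by
  induction i generalizing j with
  | zero => rw [content _ _ _ _ le_rfl]; trivial
  | succ i ih =>
    induction j with
    | zero => trivial
    | succ j ihj =>
      have key : (f i = j ∧ cnt (Hf f (i+1)) 1 (j+1) = cnt (Hf f i) 1 j + 1) ∨
          cnt (Hf f (i+1)) 1 (j+1) = cnt (Hf f i) 1 (j+1) ∨
          cnt (Hf f (i+1)) 1 (j+1) = cnt (Hf f (i+1)) 1 j := by
        simp only [Hf]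
        rw [path _ _ _ _ le_rfl, path _ _ _ _ le_rfl]
        simp only [cnt, vc]
        split_ifs <;> omega
      rcases key with ⟨h1, h2⟩ | h | h
      · rw [h2]
        exact ⟨i, by omega, by omega, h1 ▸ ih j⟩
      · rw [h]; exact Inc_mono (ih (j+1)) (by omega) le_rfl
      · rw [h]; exact Inc_mono ihj le_rfl (by omega)

lemma inc_of_le {f : ℕ → ℕ} {k k' i j : ℕ} (h : Inc f k i j) (hk : k' ≤ k) : Inc f k' i j := by
  induction k' generalizing k i j with
  | zero => trivial
  | succ k' ih =>
    obtain ⟨k, rfl⟩ : ∃ q, k = q + 1 := ⟨k - 1, by omega⟩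
    obtain ⟨p, hp, h1, h2⟩ := h
    exact ⟨p, hp, h1, ih h2 (by omega)⟩

lemma inc_iff {f : ℕ → ℕ} (hf : Function.Injective f) (k i j : ℕ) :
    Inc f k i j ↔ k ≤ cnt (Hf f i) 1 j :=
  ⟨inc_le hf, fun h => inc_of_le (le_inc f i j) h⟩

/-! Decreasing chains -/

def Dec (A : ℕ → ℕ → Prop) : ℕ → ℕ → ℕ → Prop
  | 0, _, _ => True
  | k+1, i, j => ∃ p < i, ∃ q ≥ j, A p q ∧ Dec A k p (q+1)

lemma Dec_mono {A : ℕ → ℕ → Prop} {k i j i' j' : ℕ} (h : Dec A k i j) (hi : i ≤ i')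
    (hj : j' ≤ j) : Dec A k i' j' := by
  cases k with
  | zero => trivial
  | succ k =>
    obtain ⟨p, hp, q, hq, h1, h2⟩ := h
    exact ⟨p, by omega, q, by omega, h1, h2⟩

section layer
variable {A h v : ℕ → ℕ → Prop}

lemma layer_fwd_aux
    (H1 : ∀ i j, h (i+1) j ↔ A i j ∨ (h i j ∧ ¬ v i j))
    (H2 : ∀ i j, v i (j+1) ↔ A i j ∨ (v i j ∧ ¬ h i j))
    {p y p' y' : ℕ} (a1 : A p y) (a2 : A p' y') (hp : p < p') (hy : y' < y) :
    ∃ q u, h q u ∧ v q u ∧ p < q ∧ q ≤ p' ∧ y' < u ∧ u ≤ y := by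
  by_contra! hc
  have r1 : ∀ d, p + 1 + d ≤ p' → h (p+1+d) y := by
    intro d
    induction d with
    | zero => intro _; exact (H1 _ _).2 (Or.inl a1)
    | succ d ih =>
      intro hd
      have := ih (by omega)
      refine (H1 (p+1+d) y).2 (Or.inr ⟨this, fun hv => ?_⟩)
      have := hc _ _ this hv (by omega) (by omega) hy
      omega
  have r2 : ∀ d, y' + 1 + d ≤ y → v p' (y'+1+d) := by
    intro d
    induction d with
    | zero => intro _; exact (H2 _ _).2 (Or.inl a2)
    | succ d ih =>
      intro hd
      have := ih (by omega)
      refine (H2 p' (y'+1+d)).2 (Or.inr ⟨this, fun hv => ?_⟩)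
      have := hc _ _ hv this (by omega) (by omega) (by omega)
      omega
  have s1 := r1 (p' - (p+1)) (by omega)
  have s2 := r2 (y - (y'+1)) (by omega)
  rw [show p + 1 + (p' - (p+1)) = p' by omega] at s1
  rw [show y' + 1 + (y - (y'+1)) = y by omega] at s2
  have := hc _ _ s1 s2 hp le_rfl hy
  omega

lemma layer_fwd
    (H1 : ∀ i j, h (i+1) j ↔ A i j ∨ (h i j ∧ ¬ v i j))
    (H2 : ∀ i j, v i (j+1) ↔ A i j ∨ (v i j ∧ ¬ h i j))
    {m p' y' : ℕ} (a2 : A p' y') (hd : Dec A m p' (y'+1)) :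
    Dec (fun i j => h i j ∧ v i j) m (p'+1) (y'+1) := by
  induction m generalizing p' y' with
  | zero => trivial
  | succ m ih =>
    obtain ⟨p, hp, y, hy, a1, hd'⟩ := hd
    obtain ⟨q, u, h1, h2, h3, h4, h5, h6⟩ := layer_fwd_aux H1 H2 a1 a2 hp (by omega : y' < y)
    exact ⟨q, by omega, u, by omega, ⟨h1, h2⟩, Dec_mono (ih a1 hd') (by omega) (by omega)⟩

lemma trace_h (H0 : ∀ j, ¬ h 0 j)
    (H1 : ∀ i j, h (i+1) j ↔ A i j ∨ (h i j ∧ ¬ v i j)) {q u : ℕ} (hq : h q u) :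
    ∃ p < q, A p u ∧ ∀ t, p < t → t < q → h t u ∧ ¬ v t u := by
  induction q with
  | zero => exact absurd hq (H0 u)
  | succ q ih =>
    rcases (H1 q u).1 hq with h1 | ⟨h1, h2⟩
    · exact ⟨q, by omega, h1, fun t _ _ => by omega⟩
    · obtain ⟨p, hp, ha, hb⟩ := ih h1
      refine ⟨p, by omega, ha, fun t ht1 ht2 => ?_⟩
      by_cases e : t = q
      · subst e; exact ⟨h1, h2⟩
      · exact hb t ht1 (by omega)

lemma layer_bwd (H0 : ∀ j, ¬ h 0 j) (V0 : ∀ i, ¬ v i 0)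
    (H1 : ∀ i j, h (i+1) j ↔ A i j ∨ (h i j ∧ ¬ v i j))
    (H2 : ∀ i j, v i (j+1) ↔ A i j ∨ (v i j ∧ ¬ h i j))
    {m q u : ℕ} (h1 : h q u) (h2 : v q u)
    (hd : Dec (fun i j => h i j ∧ v i j) m q (u+1)) : Dec A (m+1) q u := by
  induction m generalizing q u with
  | zero =>
    obtain ⟨p, hp, ha, -⟩ := trace_h H0 H1 h1
    exact ⟨p, hp, u, le_rfl, ha, trivial⟩
  | succ m ih =>
    obtain ⟨q', hq', u', hu', ⟨h1', h2'⟩, hd'⟩ := hd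
    have IH := ih h1' h2' hd'
    obtain ⟨p, hp, ha, hb⟩ := trace_h H0 H1 h1
    obtain ⟨y, hy, ha', hb'⟩ := trace_h (h := fun j i => v i j) (v := fun j i => h i j)
      (A := fun j i => A i j) V0 (fun j i => H2 i j) h2'
    by_cases c1 : u ≤ y
    · exact ⟨q', hq', y, c1, ha', Dec_mono IH le_rfl hy⟩
    by_cases c2 : q' ≤ p
    · exact ⟨p, hp, u, le_rfl, ha, Dec_mono IH c2 (by omega)⟩
    exfalso
    have x1 := hb q' (by omega) hq'
    have x2 := hb' u (by omega) (by omega)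
    exact x1.2 x2.1

end layer

def S (f : ℕ → ℕ) : ℕ → ℕ → ℕ → Prop
  | 0, i, j => f i = j
  | r+1, i, j => Hf f i j = r+1 ∧ Vf f i j = r+1

lemma S_H {f : ℕ → ℕ} (hf : Function.Injective f) (r i j : ℕ) :
    Hf f (i+1) j = r+1 ↔ S f r i j ∨ (Hf f i j = r+1 ∧ ¬ Vf f i j = r+1) := by
  have d1 := Hf_diag hf i
  have d2 := vc_zero (Hf f i) (f i) (f i) le_rfl
  simp only [Hf, hs, Vf]
  by_cases hj : j = f i
  · subst hj
    rw [d1, d2]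
    cases r <;> simp [S, Vf, d1]
  · cases r with
    | zero => simp only [S]; split_ifs <;> omega
    | succ r => simp only [S, Vf]; split_ifs <;> omega

lemma S_V {f : ℕ → ℕ} (hf : Function.Injective f) (r i j : ℕ) :
    Vf f i (j+1) = r+1 ↔ S f r i j ∨ (Vf f i j = r+1 ∧ ¬ Hf f i j = r+1) := by
  have d1 := Hf_diag hf i
  have d2 := vc_zero (Hf f i) (f i) (f i) le_rfl
  simp only [Vf, vc]
  by_cases hj : j = f i
  · subst hj
    rw [d1, d2]
    cases r <;> simp [S, Vf, d1]
  · cases r with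
    | zero => simp only [S]; split_ifs <;> omega
    | succ r => simp only [S, Vf]; split_ifs <;> omega

lemma dec_fwd {f : ℕ → ℕ} (hf : Function.Injective f) (m r i j : ℕ)
    (h : Dec (S f r) (m+1) i j) : Dec (S f (r+1)) m i j := by
  obtain ⟨p, hp, q, hq, h1, h2⟩ := h
  exact Dec_mono (layer_fwd (S_H hf r) (S_V hf r) h1 h2) hp (by omega)

lemma dec_bwd {f : ℕ → ℕ} (hf : Function.Injective f) (m r i : ℕ)
    (h : Dec (S f (r+1)) (m+1) i 0) : Dec (S f r) (m+2) i 0 := by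
  obtain ⟨q, hq, u, hu, ⟨h1, h1'⟩, h2⟩ := h
  have := layer_bwd (A := S f r) (h := fun i j => Hf f i j = r+1) (v := fun i j => Vf f i j = r+1)
    (by simp [Hf]) (by simp [Vf, vc]) (S_H hf r) (S_V hf r) h1 h1' h2
  obtain ⟨y, hy, ha, -⟩ := trace_h (h := fun j i => Vf f i j = r+1)
      (v := fun j i => Hf f i j = r+1)
      (A := fun j i => S f r i j) (by simp [Vf, vc]) (fun j i => S_V hf r i j) h1'
  exact ⟨q, hq, y, by omega, ha, Dec_mono this le_rfl hy⟩

lemma dec_iff {f : ℕ → ℕ} (hf : Function.Injective f) (l m : ℕ) (hl : 1 ≤ l) :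
    Dec (S f 0) l m 0 ↔ ∃ j, l ≤ Hf f m j := by
  constructor
  · intro h
    have : ∀ d, d < l → Dec (S f d) (l - d) m 0 := by
      intro d
      induction d with
      | zero => intro _; exact h
      | succ d ih =>
        intro hd
        have := ih (by omega)
        rw [show l - d = (l - (d+1)) + 1 by omega] at this
        exact dec_fwd hf _ _ _ _ this
    have h1 := this (l-1) (by omega)
    rw [show l - (l-1) = 0 + 1 by omega] at h1
    obtain ⟨p, hp, q, hq, h2, -⟩ := h1
    refine ⟨q, ?_⟩
    have h3 := (S_H hf (l-1) p q).2 (Or.inl h2)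
    have h4 : Hf f (p+1) q ≤ Hf f m q := Hf_mono f q hp
    omega
  · rintro ⟨j, hj⟩
    obtain ⟨r, hr⟩ : ∃ r, Hf f m j = r + 1 := ⟨Hf f m j - 1, by omega⟩
    obtain ⟨p, hp, ha, -⟩ := trace_h (A := S f r) (h := fun i j => Hf f i j = r+1)
      (v := fun i j => Vf f i j = r+1) (by simp [Hf]) (S_H hf r) hr
    have : ∀ d, d ≤ r → Dec (S f (r - d)) (d+1) m 0 := by
      intro d
      induction d with
      | zero => intro _; exact ⟨p, hp, j, by omega, ha, trivial⟩
      | succ d ih =>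
        intro hd
        have := ih (by omega)
        rw [show r - d = (r - (d+1)) + 1 by omega] at this
        exact dec_bwd hf _ _ _ this
    have h1 := this r le_rfl
    rw [Nat.sub_self] at h1
    have mono : ∀ k k' i j, Dec (S f 0) k i j → k' ≤ k → Dec (S f 0) k' i j := by
      intro k k'
      induction k' generalizing k with
      | zero => intros; trivial
      | succ k' ih =>
        intro i j h hk
        obtain ⟨k, rfl⟩ : ∃ q, k = q + 1 := ⟨k - 1, by omega⟩
        obtain ⟨p, hp, q, hq, h1, h2⟩ := h
        exact ⟨p, hp, q, hq, h1, ih _ _ _ h2 (by omega)⟩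
    exact mono _ _ _ _ h1 (by omega)

/-! Translation to patterns -/

def Ch (R : ℕ → ℕ → Prop) (k : ℕ) (P : ℕ → Prop) : Prop :=
  ∃ φ : Fin k → ℕ, (∀ a b, a < b → R (φ a) (φ b)) ∧ ∀ a, P (φ a)

lemma Ch_succ (R : ℕ → ℕ → Prop) (k : ℕ) (P : ℕ → Prop) :
    Ch R (k+1) P ↔ ∃ p, P p ∧ Ch R k (fun q => P q ∧ R q p) := by
  constructor
  · rintro ⟨φ, h1, h2⟩
    refine ⟨φ (Fin.last k), h2 _, fun a => φ a.castSucc, fun a b hab => h1 _ _ ?_,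
      fun a => ⟨h2 _, h1 _ _ ?_⟩⟩
    · exact Fin.castSucc_lt_castSucc_iff.2 hab
    · exact Fin.castSucc_lt_last a
  · rintro ⟨p, hp, φ, h1, h2⟩
    refine ⟨Fin.snoc (α := fun _ => ℕ) φ p, ?_, ?_⟩
    · intro a b
      refine Fin.lastCases ?_ (fun b => ?_) b
      · refine Fin.lastCases ?_ (fun a => ?_) a
        · intro h; exact absurd h (lt_irrefl _)
        · intro _
          rw [Fin.snoc_last, Fin.snoc_castSucc]; exact (h2 a).2
      · refine Fin.lastCases ?_ (fun a => ?_) a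
        · intro h; exact absurd h (not_lt.2 (Fin.le_last _))
        · intro h
          rw [Fin.snoc_castSucc, Fin.snoc_castSucc]
          exact h1 _ _ (Fin.castSucc_lt_castSucc_iff.1 h)
    · intro a
      refine Fin.lastCases ?_ (fun a => ?_) a
      · rw [Fin.snoc_last]; exact hp
      · rw [Fin.snoc_castSucc]; exact (h2 a).1

lemma Ch_congr {R : ℕ → ℕ → Prop} {k : ℕ} {P Q : ℕ → Prop} (h : ∀ p, P p ↔ Q p) :
    Ch R k P ↔ Ch R k Q := by
  rw [show P = Q from funext fun p => propext (h p)]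

lemma inc_ch (f : ℕ → ℕ) (k i j : ℕ) :
    Inc f k i j ↔ Ch (fun p q => p < q ∧ f p < f q) k (fun p => p < i ∧ f p < j) := by
  induction k generalizing i j with
  | zero => exact ⟨fun _ => ⟨Fin.elim0, fun a => a.elim0, fun a => a.elim0⟩, fun _ => trivial⟩
  | succ k ih =>
    rw [Ch_succ]
    simp only [Inc]
    constructor
    · rintro ⟨p, h1, h2, h3⟩
      refine ⟨p, ⟨h1, h2⟩, (Ch_congr ?_).1 ((ih _ _).1 h3)⟩
      intro q; constructor <;> (intro h; omega)
    · rintro ⟨p, ⟨h1, h2⟩, h3⟩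
      refine ⟨p, h1, h2, (ih _ _).2 ((Ch_congr ?_).1 h3)⟩
      intro q; constructor <;> (intro h; omega)

lemma dec_ch (f : ℕ → ℕ) (k i j : ℕ) :
    Dec (S f 0) k i j ↔ Ch (fun p q => p < q ∧ f q < f p) k (fun p => p < i ∧ j ≤ f p) := by
  induction k generalizing i j with
  | zero => exact ⟨fun _ => ⟨Fin.elim0, fun a => a.elim0, fun a => a.elim0⟩, fun _ => trivial⟩
  | succ k ih =>
    rw [Ch_succ]
    simp only [Dec]
    constructor
    · rintro ⟨p, h1, q, h2, h3, h4⟩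
      have h3 : f p = q := h3
      subst h3
      refine ⟨p, ⟨h1, h2⟩, (Ch_congr ?_).1 ((ih _ _).1 h4)⟩
      intro q; constructor <;> (intro h; omega)
    · rintro ⟨p, ⟨h1, h2⟩, h3⟩
      refine ⟨p, h1, f p, h2, rfl, (ih _ _).2 ((Ch_congr ?_).1 h3)⟩
      intro q; constructor <;> (intro h; omega)

lemma hasIncr_iff {m : ℕ} (τ : Fin m → Fin m) (f : ℕ → ℕ) (hf : Function.Injective f)
    (H : ∀ a b : Fin m, f a < f b ↔ τ a < τ b) (k : ℕ) :
    HasIncr k m τ ↔ ∃ B, k ≤ cnt (Hf f m) 1 B := by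
  simp_rw [← inc_iff hf, inc_ch]
  constructor
  · rintro ⟨g, h1, h2⟩
    refine ⟨(Finset.range m).sup f + 1, fun a => g a, fun a b hab => ⟨h1 hab, (H _ _).2 (h2 hab)⟩,
      fun a => ⟨(g a).2, Nat.lt_succ_of_le (Finset.le_sup (f := f) (by simp))⟩⟩
  · rintro ⟨B, φ, h1, h2⟩
    exact ⟨fun a => ⟨φ a, (h2 a).1⟩, fun a b hab => (h1 a b hab).1,
      fun a b hab => (H _ _).1 (h1 a b hab).2⟩

lemma hasDecr_iff {m : ℕ} (τ : Fin m → Fin m) (f : ℕ → ℕ) (hf : Function.Injective f)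
    (H : ∀ a b : Fin m, f a < f b ↔ τ a < τ b) (l : ℕ) (hl : 1 ≤ l) :
    HasDecr l m τ ↔ ∃ j, l ≤ Hf f m j := by
  rw [← dec_iff hf l m hl, dec_ch]
  constructor
  · rintro ⟨g, h1, h2⟩
    exact ⟨fun a => g a, fun a b hab => ⟨h1 hab, (H _ _).2 (h2 hab)⟩,
      fun a => ⟨(g a).2, Nat.zero_le _⟩⟩
  · rintro ⟨φ, h1, h2⟩
    exact ⟨fun a => ⟨φ a, (h2 a).1⟩, fun a b hab => (h1 a b hab).1,
      fun a b hab => (H _ _).1 (h1 a b hab).2⟩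

def Bad (k l : ℕ) (h : ℕ → ℕ) : Prop := (∃ B, k ≤ cnt h 1 B) ∨ ∃ j, l ≤ h j

lemma containsPat_iff {m : ℕ} (τ : Fin m → Fin m) (f : ℕ → ℕ) (hf : Function.Injective f)
    (H : ∀ a b : Fin m, f a < f b ↔ τ a < τ b) (k l : ℕ) (hl : 1 ≤ l) :
    ContainsPat k l m τ ↔ Bad k l (Hf f m) := by
  unfold ContainsPat Bad
  rw [hasIncr_iff τ f hf H, hasDecr_iff τ f hf H l hl]

def fs {n : ℕ} (σ : Fin n → Fin n) (i : ℕ) : ℕ :=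
  if h : i < n then 2 * (σ ⟨i, h⟩ : ℕ) + 1 else 2 * i + 1

lemma fs_coe {n : ℕ} (σ : Fin n → Fin n) (a : Fin n) : fs σ a = 2 * (σ a : ℕ) + 1 := by
  simp [fs]

lemma fs_inj {n : ℕ} (σ : Equiv.Perm (Fin n)) : Function.Injective (fs σ) := by
  intro a b hab
  unfold fs at hab
  split_ifs at hab with h1 h2 h2
  · have : σ ⟨a, h1⟩ = σ ⟨b, h2⟩ := Fin.ext (by omega)
    have := σ.injective this
    simpa using this
  · have := (σ ⟨a, h1⟩).2
    omega
  · have := (σ ⟨b, h2⟩).2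
    omega
  · omega

lemma fs_odd {n : ℕ} (σ : Fin n → Fin n) (i : ℕ) : fs σ i % 2 = 1 := by
  unfold fs; split_ifs <;> omega

lemma ext_inj {n : ℕ} (σ : Equiv.Perm (Fin n)) (i : ℕ) :
    Function.Injective (Function.update (fs σ) n (2*i)) := by
  intro a b hab
  have h1 := fs_odd σ a
  have h2 := fs_odd σ b
  by_cases ha : a = n <;> by_cases hb : b = n
  · omega
  · subst ha
    rw [Function.update_self, Function.update_of_ne hb] at hab; omega
  · subst hb
    rw [Function.update_self, Function.update_of_ne ha] at hab; omega
  · rw [Function.update_of_ne ha, Function.update_of_ne hb] at hab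
    exact fs_inj σ hab

lemma ext_ord {n : ℕ} (σ : Equiv.Perm (Fin n)) (i : Fin (n+1)) (a b : Fin (n+1)) :
    Function.update (fs σ) n (2*i) a < Function.update (fs σ) n (2*i) b ↔
      rightExt σ i a < rightExt σ i b := by
  have key : ∀ a : Fin (n+1), Function.update (fs σ) n (2*i) a =
      (if rightExt σ i a < i then 2 * (rightExt σ i a : ℕ) + 1 else
        if rightExt σ i a = i then 2 * (i : ℕ) else 2 * (rightExt σ i a : ℕ) - 1) := by
    intro a
    refine Fin.lastCases ?_ (fun a => ?_) a
    · simp [rightExt]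
    · have e : rightExt (⇑σ) i a.castSucc = i.succAbove (σ a) := by simp [rightExt]
      rw [e, Fin.val_castSucc, Function.update_of_ne (by have := a.2; omega), fs_coe,
        if_neg (Fin.succAbove_ne _ _)]
      simp only [Fin.succAbove, Fin.lt_def]
      split_ifs <;> simp_all <;> omega
  rw [key, key]
  generalize rightExt (⇑σ) i a = x
  generalize rightExt (⇑σ) i b = y
  simp only [Fin.lt_def, Fin.ext_iff]
  split_ifs <;> omega

def Pw {n : ℕ} (σ : Equiv.Perm (Fin n)) : ℕ → ℕ := Hf (fs σ) n
def Qw {n : ℕ} (σ : Equiv.Perm (Fin n)) (i : ℕ) : ℕ := Vf (fs σ) i (2*n)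

def Cr (k l n : ℕ) (h : ℕ → ℕ) : Prop := ¬ Bad k l h ∧ ∀ i ≤ n, Bad k l (hs h (2*i))

lemma rightCrucial_iff {n : ℕ} (σ : Equiv.Perm (Fin n)) (k l : ℕ) (hl : 1 ≤ l) :
    RightCrucial k l n σ ↔ Cr k l n (Pw σ) := by
  have h1 : AvoidsPat k l n σ ↔ ¬ Bad k l (Pw σ) := by
    rw [Pw, ← containsPat_iff (⇑σ) (fs σ) (fs_inj σ) (fun a b => by
      rw [fs_coe, fs_coe, Fin.lt_def]; omega) k l hl]
    simp [AvoidsPat, ContainsPat]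
  have h2 : ∀ i : Fin (n+1), ContainsPat k l (n+1) (rightExt σ i) ↔ Bad k l (hs (Pw σ) (2*i)) := by
    intro i
    rw [containsPat_iff _ _ (ext_inj σ i) (ext_ord σ i) k l hl]
    simp only [Hf, Function.update_self, Pw]
    rw [Hf_congr (g := fs σ) (fun j hj => Function.update_of_ne (by omega) _ _)]
  unfold RightCrucial Cr
  rw [h1]
  refine and_congr_right fun _ => ?_
  constructor
  · intro h i hi
    exact (h2 ⟨i, by omega⟩).1 (h ⟨i, by omega⟩)
  · intro h i
    exact (h2 i).2 (h i (by have := i.2; omega))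

lemma Pw_supp {n : ℕ} (σ : Equiv.Perm (Fin n)) (j : ℕ) :
    Pw σ j ≠ 0 ↔ j % 2 = 1 ∧ j < 2 * n := by
  rw [Pw, Hf_ne_zero]
  constructor
  · rintro ⟨p, hp, rfl⟩
    refine ⟨fs_odd _ _, ?_⟩
    have := (σ ⟨p, hp⟩).2
    simp only [fs, hp, dite_true]
    omega
  · rintro ⟨h1, h2⟩
    refine ⟨σ.symm ⟨j/2, by omega⟩, Fin.is_lt _, ?_⟩
    rw [fs_coe]
    simp
    omega

lemma Qw_pos {n : ℕ} (σ : Equiv.Perm (Fin n)) (i : ℕ) (hi : i < n) : 1 ≤ Qw σ i := by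
  refine vc_pos _ _ _ (Hf_diag (fs_inj σ) i) ?_
  have := (σ ⟨i, hi⟩).2
  simp only [fs, hi, dite_true]
  omega

/-! Reverse -/

lemma revcol (M : ℕ) : ∀ (h' : ℕ → ℕ) (c : ℕ), 1 ≤ c → (∀ j ≤ M, Part h' j) →
    (∀ r, 1 ≤ r → cnt h' (r+1) M + (if c = r then 1 else 0) ≤
      cnt h' r M + (if c = r+1 then 1 else 0)) →
    ∃ h y, y < M ∧ h y = 0 ∧ (∀ j < M, hs h y j = h' j) ∧ vc h y M = c ∧
      (∀ j, M ≤ j → h j = h' j) ∧ ∀ j ≤ M, Part h j := by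
  induction M with
  | zero =>
    intro h' c hc _ h2
    have := h2 c hc
    simp [cnt] at this
  | succ M ih =>
    intro h' c hc h1 h2
    -- it suffices to find the column without the last partition property
    suffices ∃ h y, y < M + 1 ∧ h y = 0 ∧ (∀ j < M + 1, hs h y j = h' j) ∧ vc h y (M+1) = c ∧
      (∀ j, M + 1 ≤ j → h j = h' j) ∧ ∀ j ≤ M, Part h j by
      obtain ⟨h, y, q1, q2, q3, q4, q5, q6⟩ := this
      refine ⟨h, y, q1, q2, q3, q4, q5, ?_⟩
      intro j hj
      by_cases e : j = M + 1
      · subst e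
        intro r hr
        have p1 := path h y r (M+1) hr
        have p2 := path h y (r+1) (M+1) (by omega)
        rw [cnt_congr q3, q4] at p1 p2
        have := h2 r hr
        omega
      · exact q6 j (by omega)
    by_cases e : h' M = c
    · by_cases e1 : c = 1
      · subst e1
        have hlow : ∀ j < M, Function.update h' M 0 j = h' j := fun j hj =>
          Function.update_of_ne (by omega) _ _
        refine ⟨Function.update h' M 0, M, by omega, by simp, ?_, ?_, ?_, ?_⟩
        · intro j hj
          by_cases ej : j = M
          · subst ej
            simp [hs, vc_zero _ _ _ le_rfl, e]
          · simp only [hs]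
            rw [vc_zero _ _ _ (by omega), hlow j (by omega), if_neg (by omega)]
        · simp [vc, vc_zero _ _ _ le_rfl]
        · intro j hj
          exact Function.update_of_ne (by omega) _ _
        · intro j hj r hr
          rw [cnt_congr (fun i hi => hlow i (by omega)), cnt_congr (fun i hi => hlow i (by omega))]
          exact h1 j (by omega) r hr
      · have hlow : ∀ j < M, Function.update h' M (c-1) j = h' j := fun j hj =>
          Function.update_of_ne (by omega) _ _
        obtain ⟨h, y, q1, q2, q3, q4, q5, q6⟩ := ih (Function.update h' M (c-1)) (c-1) (by omega)
          (by
            intro j hj r hr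
            rw [cnt_congr (fun i hi => hlow i (by omega)),
              cnt_congr (fun i hi => hlow i (by omega))]
            exact h1 j (by omega) r hr)
          (by
            intro r hr
            rw [cnt_congr (fun i hi => hlow i (by omega)),
              cnt_congr (fun i hi => hlow i (by omega))]
            have t1 := h1 M (by omega) r hr
            have t2 := h1 (M+1) (by omega) r hr
            simp only [cnt] at t2
            split_ifs at * <;> omega)
        have hM : h M = c - 1 := by rw [q5 M le_rfl]; simp
        refine ⟨h, y, by omega, q2, ?_, ?_, ?_, q6⟩
        · intro j hj
          by_cases ej : j = M
          · subst ej
            simp only [hs]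
            rw [q4, hM, if_pos (by omega)]; omega
          · rw [q3 j (by omega), hlow j (by omega)]
        · simp only [vc]
          rw [q4, hM, if_pos (by omega)]; omega
        · intro j hj
          rw [q5 j (by omega)]
          exact Function.update_of_ne (by omega) _ _
    · obtain ⟨h, y, q1, q2, q3, q4, q5, q6⟩ := ih h' c hc (fun j hj => h1 j (by omega)) (by
        intro r hr
        have t1 := h1 M (by omega) r hr
        have t2 := h1 (M+1) (by omega) r hr
        have t3 := h2 r hr
        simp only [cnt] at t2 t3
        split_ifs at * <;> omega)
      have hM := q5 M le_rfl
      refine ⟨h, y, by omega, q2, ?_, ?_, fun j hj => q5 j (by omega), q6⟩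
      · intro j hj
        by_cases ej : j = M
        · subst ej
          simp only [hs]
          rw [q4, hM, if_neg (by omega)]
        · exact q3 j (by omega)
      · simp only [vc]
        rw [q4, hM, if_neg (by omega)]

lemma cnt_eq_zero {h : ℕ → ℕ} {r j i : ℕ} (H : cnt h r j = 0) (hi : i < j) : h i ≠ r := by
  intro e
  have := cnt_mono h r hi
  simp only [cnt, e, if_true] at this
  omega

lemma revAll (M : ℕ) (Q : ℕ → ℕ) (N : ℕ) : ∀ (h : ℕ → ℕ), (∀ j ≤ M, Part h j) →
    (∀ j, M ≤ j → h j = 0) → (∀ i < N, 1 ≤ Q i) → (∀ i ≤ N, Part Q i) →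
    (∀ r, 1 ≤ r → cnt h r M = cnt Q r N) →
    ∃ f : ℕ → ℕ, (∀ i < N, f i < M) ∧ Hf f N = h ∧ (∀ i < N, Vf f i M = Q i) ∧
      ∀ i < N, Hf f i (f i) = 0 := by
  induction N with
  | zero =>
    intro h _ h2 _ _ h5
    refine ⟨fun _ => 0, by simp, ?_, by simp, by simp⟩
    funext j
    simp only [Hf]
    by_contra hj
    have hjM : j < M := by
      by_contra hc
      exact hj (h2 j (by omega)).symm
    exact cnt_eq_zero (h5 (h j) (by omega)) hjM rfl
  | succ N ih =>
    intro h h1 h2 h3 h4 h5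
    have hc := h3 N (by omega)
    obtain ⟨g, y, q1, q2, q3, q4, q5, q6⟩ := revcol M h (Q N) hc h1 (by
      intro r hr
      rw [h5 r hr, h5 (r+1) (by omega)]
      have := h4 N (by omega) r hr
      simp only [cnt]
      omega)
    have hg : ∀ j, M ≤ j → g j = 0 := fun j hj => by rw [q5 j hj, h2 j hj]
    have hsg : hs g y = h := by
      funext j
      by_cases hj : j < M
      · exact q3 j hj
      · have t1 : 1 ≤ vc g y j := vc_pos _ _ _ q2 (by omega)
        simp only [hs]
        rw [hg j (by omega), h2 j (by omega), if_neg (by omega)]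
    obtain ⟨f, w1, w2, w3, w4⟩ := ih g q6 hg (fun i hi => h3 i (by omega))
      (fun i hi => h4 i (by omega)) (by
        intro r hr
        have p := path g y r M hr
        rw [hsg, q4, h5 r hr] at p
        simp only [cnt] at p
        omega)
    have hu : ∀ i < N, Function.update f N y i = f i := fun i hi =>
      Function.update_of_ne (by omega) _ _
    have hH : ∀ i ≤ N, Hf (Function.update f N y) i = Hf f i := fun i hi =>
      Hf_congr (fun j hj => hu j (by omega))
    refine ⟨Function.update f N y, ?_, ?_, ?_, ?_⟩
    · intro i hi
      by_cases e : i = N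
      · subst e; simpa using q1
      · rw [hu i (by omega)]; exact w1 i (by omega)
    · simp only [Hf, Function.update_self]
      rw [hH N le_rfl, w2, hsg]
    · intro i hi
      by_cases e : i = N
      · subst e
        simp only [Vf, Function.update_self]
        rw [hH i le_rfl, w2, q4]
      · rw [Vf_congr (g := f) (fun j hj => hu j (by omega))]; exact w3 i (by omega)
    · intro i hi
      by_cases e : i = N
      · subst e
        rw [hH i le_rfl, w2]; simpa using q2
      · rw [hu i (by omega), hH i (by omega)]; exact w4 i (by omega)

lemma exists_perm (n : ℕ) (h Q : ℕ → ℕ) (hsupp : ∀ j, h j ≠ 0 ↔ j % 2 = 1 ∧ j < 2 * n)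
    (h1 : ∀ j, Part h j) (h3 : ∀ i < n, 1 ≤ Q i) (h4 : ∀ i ≤ n, Part Q i)
    (h5 : ∀ r, 1 ≤ r → cnt h r (2*n) = cnt Q r n) :
    ∃ σ : Equiv.Perm (Fin n), Pw σ = h ∧ ∀ i < n, Qw σ i = Q i := by
  obtain ⟨f, w1, w2, w3, w4⟩ := revAll (2*n) Q n h (fun j _ => h1 j) (fun j hj => by
    by_contra hc
    have := (hsupp j).1 hc
    omega) h3 h4 h5
  have hodd : ∀ i < n, f i % 2 = 1 ∧ f i < 2 * n := by
    intro i hi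
    rw [← hsupp, ← w2, Hf_ne_zero]
    exact ⟨i, hi, rfl⟩
  have hinj' : ∀ a b, a < b → b < n → f a ≠ f b := by
    intro a b hab hb e
    exact (Hf_ne_zero f b (f b)).2 ⟨a, hab, e⟩ (w4 b hb)
  let s : Fin n → Fin n := fun i => ⟨f i / 2, by have := (hodd i i.2).2; omega⟩
  have hinj : Function.Injective s := by
    intro a b hab
    have e : f a / 2 = f b / 2 := congrArg Fin.val hab
    have o1 := hodd a a.2
    have o2 := hodd b b.2
    have e : f a = f b := by omega
    rcases lt_trichotomy a b with h | h | h
    · exact absurd e (hinj' a b h b.2)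
    · exact h
    · exact absurd e.symm (hinj' b a h a.2)
  let σ : Equiv.Perm (Fin n) := Equiv.ofBijective s (Finite.injective_iff_bijective.1 hinj)
  have hfs : ∀ i < n, fs σ i = f i := by
    intro i hi
    have := hodd i hi
    have e : (σ ⟨i, hi⟩ : ℕ) = f i / 2 := rfl
    simp only [fs, hi, dite_true, e]
    omega
  refine ⟨σ, ?_, ?_⟩
  · rw [Pw, Hf_congr hfs, w2]
  · intro i hi
    rw [Qw, Vf_congr (g := f) (fun j hj => hfs j (by omega)), w3 i hi]

lemma col_inj {h g : ℕ → ℕ} {y z M : ℕ} (hy : h y = 0) (hz : g z = 0) (yM : y < M)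
    (e1 : ∀ j < M, hs h y j = hs g z j) (e2 : vc h y M = vc g z M) :
    y = z ∧ ∀ j < M, h j = g j := by
  have loc : ∀ j < M, vc h y (j+1) = vc g z (j+1) →
      vc h y j = vc g z j ∧ h j = g j ∧ (j = y ↔ j = z) := by
    intro j hj hv
    have e := e1 j hj
    have a1 : j = y → h j = 0 ∧ vc h y j = 0 := fun e => by
      subst e; exact ⟨hy, vc_zero _ _ _ le_rfl⟩
    have a2 : j = z → g j = 0 ∧ vc g z j = 0 := fun e => by
      subst e; exact ⟨hz, vc_zero _ _ _ le_rfl⟩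
    simp only [hs, vc] at e hv
    generalize vc h y j = v1 at *
    generalize vc g z j = v2 at *
    generalize h j = x1 at *
    generalize g j = x2 at *
    clear e1 e2 hy hz
    split_ifs at e hv <;> omega
  have all : ∀ d ≤ M, vc h y (M - d) = vc g z (M - d) := by
    intro d
    induction d with
    | zero => intro _; exact e2
    | succ d ih =>
      intro hd
      refine (loc (M - (d+1)) (by omega) ?_).1
      rw [show M - (d+1) + 1 = M - d by omega]
      exact ih (by omega)
  have all' : ∀ j < M, vc h y (j+1) = vc g z (j+1) := by
    intro j hj
    have := all (M - (j+1)) (by omega)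
    rwa [show M - (M - (j+1)) = j + 1 by omega] at this
  exact ⟨(loc y yM (all' y yM)).2.2.1 rfl, fun j hj => (loc j hj (all' j hj)).2.1⟩

lemma all_inj (M : ℕ) (f g : ℕ → ℕ) (hf : Function.Injective f) (hg : Function.Injective g)
    (N : ℕ) (fM : ∀ i < N, f i < M) (gM : ∀ i < N, g i < M)
    (e1 : Hf f N = Hf g N) (e2 : ∀ i < N, Vf f i M = Vf g i M) : ∀ i < N, f i = g i := by
  induction N with
  | zero => simp
  | succ N ih =>
    obtain ⟨a1, a2⟩ := col_inj (M := M) (Hf_diag hf N) (Hf_diag hg N) (fM N (by omega))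
      (fun j _ => congrFun e1 j) (e2 N (by omega))
    have a3 : Hf f N = Hf g N := by
      funext j
      by_cases hj : j < M
      · exact a2 j hj
      · have z : ∀ (f : ℕ → ℕ), (∀ i < N + 1, f i < M) → Hf f N j = 0 := by
          intro f fM
          by_contra hc
          obtain ⟨p, hp, e⟩ := (Hf_ne_zero _ _ _).1 hc
          have := fM p (by omega)
          omega
        rw [z f fM, z g gM]
    intro i hi
    by_cases e : i = N
    · subst e; exact a1
    · exact ih (fun i hi => fM i (by omega)) (fun i hi => gM i (by omega)) a3
        (fun i hi => e2 i (by omega)) i (by omega)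

lemma perm_inj {n : ℕ} {σ τ : Equiv.Perm (Fin n)} (h1 : Pw σ = Pw τ)
    (h2 : ∀ i < n, Qw σ i = Qw τ i) : σ = τ := by
  have b : ∀ (σ : Equiv.Perm (Fin n)), ∀ i < n, fs σ i < 2 * n := by
    intro σ i hi
    have := (σ ⟨i, hi⟩).2
    simp only [fs, hi, dite_true]
    omega
  have := all_inj (2*n) (fs σ) (fs τ) (fs_inj σ) (fs_inj τ) n (b σ) (b τ) h1 h2
  ext a
  have := this a a.2
  rw [fs_coe, fs_coe] at this
  omega


/-! Adding a box -/

def Dat (n : ℕ) (h Q : ℕ → ℕ) : Prop :=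
  (∀ j, h j ≠ 0 ↔ j % 2 = 1 ∧ j < 2 * n) ∧ (∀ j, Part h j) ∧ (∀ i < n, 1 ≤ Q i) ∧
    (∀ i ≤ n, Part Q i) ∧ (∀ r, 1 ≤ r → cnt h r (2*n) = cnt Q r n)

lemma cnt_out {h : ℕ → ℕ} {M r : ℕ} (H : ∀ j, M ≤ j → h j = 0) (hr : 1 ≤ r) (B : ℕ) :
    cnt h r B ≤ cnt h r M := by
  induction B with
  | zero => simp [cnt]
  | succ B ih =>
    by_cases hB : B < M
    · exact cnt_mono _ _ hB
    · simp only [cnt]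
      rw [H B (by omega), if_neg (by omega)]
      omega

lemma dat_perm {n : ℕ} (σ : Equiv.Perm (Fin n)) : Dat n (Pw σ) (Qw σ) := by
  refine ⟨Pw_supp σ, part_Hf _ _, Qw_pos σ, ?_, ?_⟩
  · intro i hi r hr
    have := part_Hf (fs σ) i (2*n) r hr
    rwa [content _ _ _ _ hr, content _ _ _ _ (by omega)] at this
  · intro r hr
    exact content _ _ _ _ hr

lemma cnt_update {h : ℕ → ℕ} {p c r : ℕ} (hp : h p = 0) (hr : 1 ≤ r) (j : ℕ) :
    cnt (Function.update h p c) r j = cnt h r j + if p < j ∧ c = r then 1 else 0 := by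
  induction j with
  | zero => simp [cnt]
  | succ j ih =>
    simp only [cnt, ih]
    by_cases e : j = p
    · subst e
      rw [Function.update_self, hp]
      split_ifs <;> omega
    · rw [Function.update_of_ne e]
      split_ifs <;> omega

lemma sum_cnt (Q : ℕ → ℕ) (L n : ℕ) : ∑ r ∈ Finset.range L, cnt Q (r+1) n ≤ n := by
  induction n with
  | zero => simp [cnt]
  | succ n ih =>
    simp only [cnt, Finset.sum_add_distrib]
    have : ∑ r ∈ Finset.range L, (if Q n = r + 1 then 1 else 0) =
        if 1 ≤ Q n ∧ Q n ≤ L then 1 else 0 := by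
      clear ih
      induction L with
      | zero => rw [if_neg (by omega)]; rfl
      | succ L ihL =>
        rw [Finset.sum_range_succ, ihL]
        split_ifs <;> omega
    rw [this]
    split_ifs <;> omega

lemma bad_ones {h : ℕ → ℕ} {k l y : ℕ} (hy : h y = 0) (hk : k ≤ cnt h 1 y + 1) :
    Bad k l (hs h y) := by
  left
  refine ⟨y+1, ?_⟩
  rw [path _ _ _ _ le_rfl]
  have e : vc h y (y+1) = 1 := by simp [vc, vc_zero _ _ _ le_rfl, hy]
  rw [e, if_pos rfl]
  have := cnt_mono h 1 (Nat.le_succ y)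
  simp only [Nat.succ_eq_add_one] at this
  omega

lemma step {k l n : ℕ} (hk : 3 ≤ k) (hl : 3 ≤ l) {h Q : ℕ → ℕ} (hn : n < (k-1)*(l-1))
    (hd : Dat n h Q) (hc : Cr k l n h) :
    ∃ c, Dat (n+1) (Function.update h (2*n+1) c) (Function.update Q n c) ∧
      Cr k l (n+1) (Function.update h (2*n+1) c) := by
  obtain ⟨d1, d2, d3, d4, d5⟩ := hd
  obtain ⟨c1, c2⟩ := hc
  have hout : ∀ j, 2*n ≤ j → h j = 0 := fun j hj => by
    by_contra hne
    have := (d1 j).1 hne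
    omega
  have hlab : ∀ j, h j < l := fun j => by
    by_contra hx
    exact c1 (Or.inr ⟨j, by omega⟩)
  have hones : ∀ B, cnt h 1 B < k := fun B => by
    by_contra hx
    exact c1 (Or.inl ⟨B, by omega⟩)
  have hK : k ≤ cnt h 1 (2*n) + 1 := by
    rcases c2 n le_rfl with ⟨B, hB⟩ | ⟨j, hj⟩
    · rw [path _ _ _ _ le_rfl] at hB
      have := cnt_out hout le_rfl (r := 1) B
      split_ifs at hB <;> omega
    · exfalso
      have t := hlab j
      simp only [hs] at hj
      split_ifs at hj with hx
      · by_cases hj2 : j ≤ 2*n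
        · rw [vc_zero _ _ _ hj2] at hx
          omega
        · have := hout j (by omega)
          omega
      · omega
  have hex : ∃ r, cnt h (r+1) (2*n) < k - 1 ∧ r < l - 1 := by
    by_contra! hx
    have s1 := sum_cnt Q (l-1) n
    have s2 : ∑ r ∈ Finset.range (l-1), (k-1) ≤ ∑ r ∈ Finset.range (l-1), cnt Q (r+1) n := by
      refine Finset.sum_le_sum fun r hr => ?_
      have hr := Finset.mem_range.1 hr
      rw [← d5 (r+1) (by omega)]
      by_contra hy
      have := hx r (by omega)
      omega
    rw [Finset.sum_const, Finset.card_range, smul_eq_mul, mul_comm] at s2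
    omega
  classical
  obtain ⟨r0, ⟨m1, m2⟩, m3⟩ : ∃ r, (cnt h (r+1) (2*n) < k - 1 ∧ r < l - 1) ∧
      ∀ s < r, ¬ (cnt h (s+1) (2*n) < k - 1 ∧ s < l - 1) :=
    ⟨Nat.find hex, Nat.find_spec hex, fun s hs => Nat.find_min hex hs⟩
  have hr0 : 1 ≤ r0 := by
    by_contra hx
    have : r0 = 0 := by omega
    subst this
    simp only [zero_add] at m1
    omega
  have m4 : k - 1 ≤ cnt h r0 (2*n) := by
    have := m3 (r0 - 1) (by omega)
    rw [show r0 - 1 + 1 = r0 by omega] at this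
    omega
  have hp : h (2*n+1) = 0 := hout _ (by omega)
  have hlow : ∀ j ≤ 2*n, Function.update h (2*n+1) (r0+1) j = h j := fun j hj =>
    Function.update_of_ne (by omega) _ _
  have qlow : ∀ j < n, Function.update Q n (r0+1) j = Q j := fun j hj =>
    Function.update_of_ne (by omega) _ _
  refine ⟨r0 + 1, ⟨?_, ?_, ?_, ?_, ?_⟩, ?_, ?_⟩
  · intro j
    by_cases e : j = 2*n+1
    · subst e; simp; omega
    · rw [Function.update_of_ne e, d1]; omega
  · intro j r hr
    rw [cnt_update hp hr, cnt_update hp (by omega)]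
    have t := d2 j r hr
    by_cases hj : 2*n+1 < j
    · have u1 := cnt_out hout (r := r0+1) (by omega) j
      have u2 := cnt_mono h r0 (show 2*n ≤ j by omega)
      by_cases e : r0 = r
      · subst e
        split_ifs <;> omega
      · split_ifs <;> omega
    · rw [if_neg (by omega), if_neg (by omega)]; omega
  · intro i hi
    by_cases e : i = n
    · subst e; simp
    · rw [qlow i (by omega)]; exact d3 i (by omega)
  · intro i hi r hr
    by_cases e : i = n + 1
    · subst e
      simp only [cnt, Function.update_self]
      rw [cnt_congr qlow, cnt_congr qlow]
      have t := d4 n le_rfl r hr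
      have u1 := d5 (r0+1) (by omega)
      have u2 := d5 r0 (by omega)
      by_cases e : r0 = r
      · subst e
        split_ifs <;> omega
      · split_ifs <;> omega
    · rw [cnt_congr (fun j hj => qlow j (by omega)), cnt_congr (fun j hj => qlow j (by omega))]
      exact d4 i (by omega) r hr
  · intro r hr
    rw [cnt_update hp hr]
    simp only [cnt, Function.update_self]
    rw [cnt_congr qlow, ← d5 r hr]
    have := cnt_out hout hr (2*(n+1))
    have := cnt_mono h r (show 2*n ≤ 2*(n+1) by omega)
    split_ifs <;> omega
  · rintro (⟨B, hB⟩ | ⟨j, hj⟩)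
    · rw [cnt_update hp le_rfl, if_neg (by omega)] at hB
      have := hones B
      omega
    · by_cases e : j = 2*n+1
      · subst e; rw [Function.update_self] at hj; omega
      · rw [Function.update_of_ne e] at hj
        have := hlab j
        omega
  · intro i hi
    by_cases e : i = n + 1
    · subst e
      refine bad_ones ?_ ?_
      · rw [Function.update_of_ne (by omega)]; exact hout _ (by omega)
      · rw [cnt_update hp le_rfl]
        have := cnt_mono h 1 (show 2*n ≤ 2*(n+1) by omega)
        omega
    · have key : ∀ j, hs h (2*i) j ≠ 0 →
          hs (Function.update h (2*n+1) (r0+1)) (2*i) j = hs h (2*i) j := by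
        intro j hj
        have hj2 : j ≤ 2*n := by
          by_contra hx
          rw [hs_ne_zero, hout j (by omega)] at hj
          omega
        exact hs_congr (fun a ha => hlow a (by omega))
      rcases c2 i (by omega) with ⟨B, hB⟩ | ⟨j, hj⟩
      · left
        refine ⟨B, hB.trans ?_⟩
        clear hB
        induction B with
        | zero => simp [cnt]
        | succ B ih =>
          simp only [cnt]
          by_cases e1 : hs h (2*i) B = 1
          · rw [key B (by omega)]; omega
          · rw [if_neg e1]; omega
      · right
        exact ⟨j, by rw [key j (by omega)]; exact hj⟩

/-! A crucial word which is not an extension -/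

def dbl (w : ℕ → ℕ) (N j : ℕ) : ℕ := if j % 2 = 1 ∧ j < 2*N then w (j/2) else 0

lemma cnt_dbl (w : ℕ → ℕ) (N r j : ℕ) (hr : 1 ≤ r) :
    cnt (dbl w N) r j = cnt w r (min (j/2) N) := by
  induction j with
  | zero => simp [cnt]
  | succ j ih =>
    simp only [cnt, ih]
    by_cases e : j % 2 = 1 ∧ j < 2*N
    · have e' : dbl w N j = w (j/2) := if_pos e
      rw [e', show min ((j+1)/2) N = min (j/2) N + 1 by omega]
      simp only [cnt]
      rw [show min (j/2) N = j/2 by omega]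
    · have e' : dbl w N j = 0 := if_neg e
      rw [e', if_neg (by omega), show min ((j+1)/2) N = min (j/2) N by omega]
      omega

def ww (D m j : ℕ) : ℕ := if j < m then j/D + 1 else j - m + 1

lemma cnt_u (D r j : ℕ) (hD : 1 ≤ D) :
    cnt (fun j => j/D+1) (r+1) j = min (j - r*D) D := by
  induction j with
  | zero => simp [cnt]
  | succ j ih =>
    have e : (j/D + 1 = r + 1) ↔ r*D ≤ j ∧ j < r*D + D := by
      rw [add_left_inj, Nat.div_eq_iff (by omega)]
      omega
    simp only [cnt, ih, e]
    split_ifs <;> omega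

lemma cnt_w_low (D m r j : ℕ) (hD : 1 ≤ D) (hj : j ≤ m) :
    cnt (ww D m) (r+1) j = min (j - r*D) D := by
  rw [← cnt_u D r j hD]
  exact cnt_congr (fun i hi => by simp only [ww]; rw [if_pos (by omega)])

lemma cnt_w_high (D m r t : ℕ) (hr : 1 ≤ r) :
    cnt (ww D m) r (m+t) = cnt (ww D m) r m + if r ≤ t then 1 else 0 := by
  induction t with
  | zero => rw [if_neg (by omega)]; rfl
  | succ t ih =>
    rw [← add_assoc]
    simp only [cnt, ih]
    have : ww D m (m+t) = t + 1 := by simp [ww]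
    rw [this]
    split_ifs <;> omega

lemma part_w (D m : ℕ) (hD : 1 ≤ D) (j : ℕ) : Part (ww D m) j := by
  have low : ∀ j ≤ m, Part (ww D m) j := by
    intro j hj r hr
    obtain ⟨r, rfl⟩ : ∃ q, r = q + 1 := ⟨r - 1, by omega⟩
    rw [cnt_w_low _ _ _ _ hD hj, cnt_w_low _ _ _ _ hD hj]
    have : (r+1)*D = r*D + D := by ring
    omega
  by_cases hj : j ≤ m
  · exact low j hj
  · obtain ⟨t, rfl⟩ : ∃ t, j = m + t := ⟨j - m, by omega⟩
    intro r hr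
    have := low m le_rfl r hr
    rw [cnt_w_high _ _ _ _ hr, cnt_w_high _ _ _ _ (by omega)]
    split_ifs <;> omega

lemma dat_w (D m n : ℕ) (hD : 1 ≤ D) : Dat n (dbl (ww D m) n) (ww D m) := by
  have pos : ∀ i, 1 ≤ ww D m i := fun i => by simp only [ww]; split_ifs <;> exact Nat.le_add_left 1 _
  refine ⟨?_, ?_, fun i _ => pos i, fun i _ => part_w D m hD i, ?_⟩
  · intro j
    have := pos (j/2)
    simp only [dbl]
    split_ifs with h
    · exact ⟨fun _ => h, fun _ => by omega⟩
    · exact ⟨fun h => absurd rfl h, fun h' => absurd h' h⟩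
  · intro j r hr
    rw [cnt_dbl _ _ _ _ hr, cnt_dbl _ _ _ _ (by omega)]
    exact part_w D m hD _ r hr
  · intro r hr
    rw [cnt_dbl _ _ _ _ hr]
    congr 1
    omega

lemma vc_hs (h : ℕ → ℕ) (y j : ℕ) (hj : 1 ≤ vc h y j) : ∃ i, hs h y i = vc h y j := by
  induction j with
  | zero => simp [vc] at hj
  | succ j ih =>
    by_cases c : h j = vc h y j ∧ (h j ≠ 0 ∨ j = y)
    · refine ⟨j, ?_⟩
      simp only [hs, vc]
      rw [if_pos c, if_pos c]; omega
    · simp only [vc] at hj ⊢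
      rw [if_neg c] at hj ⊢
      exact ih hj

lemma ones_w (D m : ℕ) (hD : 1 ≤ D) (hm : D + 1 ≤ m) (j : ℕ) :
    cnt (ww D m) 1 j ≤ D + if m < j then 1 else 0 := by
  by_cases hj : j ≤ m
  · rw [cnt_w_low D m 0 j hD hj]; omega
  · obtain ⟨t, rfl⟩ : ∃ t, j = m + t := ⟨j - m, by omega⟩
    rw [cnt_w_high _ _ _ _ le_rfl, cnt_w_low D m 0 m hD le_rfl]
    split_ifs <;> omega

lemma lab_w (D m L j : ℕ) (hD : 1 ≤ D) (hm : m ≤ D*L) (hj : j < m + L) : ww D m j ≤ L := by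
  simp only [ww]
  split_ifs with h
  · have : j / D < L := (Nat.div_lt_iff_lt_mul (by omega)).2 (by rw [mul_comm]; omega)
    omega
  · omega

lemma notbad_w (D m L n : ℕ) (hD : 1 ≤ D) (hm : D + 1 ≤ m) (hmL : m ≤ D*L) (hn : n ≤ m + L) :
    ¬ Bad (D+2) (L+1) (dbl (ww D m) n) := by
  rintro (⟨B, hB⟩ | ⟨j, hj⟩)
  · rw [cnt_dbl _ _ _ _ le_rfl] at hB
    have := ones_w D m hD hm (min (B/2) n)
    split_ifs at this <;> omega
  · simp only [dbl] at hj
    split_ifs at hj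
    · have := lab_w D m L (j/2) hD hmL (by omega)
      omega
    · omega

lemma cr_w (D m L : ℕ) (hD : 1 ≤ D) (hm : D + 1 ≤ m) (hmL : m ≤ D*L) :
    Cr (D+2) (L+1) (m+L) (dbl (ww D m) (m+L)) := by
  refine ⟨notbad_w D m L _ hD hm hmL le_rfl, fun i hi => ?_⟩
  have ev : ∀ i, dbl (ww D m) (m+L) (2*i) = 0 := fun i => by
    simp only [dbl]; rw [if_neg (by omega)]
  by_cases c : m < i
  · refine bad_ones (ev i) ?_
    rw [cnt_dbl _ _ _ _ le_rfl]
    obtain ⟨t, ht⟩ : ∃ t, min (2*i/2) (m+L) = m + t := ⟨i - m, by omega⟩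
    rw [ht, cnt_w_high _ _ _ _ le_rfl, cnt_w_low D m 0 m hD le_rfl, if_pos (by omega)]
    omega
  · have key : ∀ t ≤ L, t + 1 ≤ vc (dbl (ww D m) (m+L)) (2*i) (2*(m+t)+1) := by
      intro t
      induction t with
      | zero => intro _; exact vc_pos _ _ _ (ev i) (by omega)
      | succ t ih =>
        intro ht
        have h1 := ih (by omega)
        have h2 : t + 2 ≤ vc (dbl (ww D m) (m+L)) (2*i) (2*(m+t)+1+1) := by
          have e : dbl (ww D m) (m+L) (2*(m+t)+1) = t + 1 := by
            simp only [dbl]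
            rw [if_pos (by omega), show (2*(m+t)+1)/2 = m+t by omega]
            simp [ww]
          rw [vc, e]
          split_ifs <;> omega
        exact h2.trans (vc_mono _ _ (by omega))
    have h1 := key L le_rfl
    obtain ⟨j, hj⟩ := vc_hs _ _ _ (show 1 ≤ vc (dbl (ww D m) (m+L)) (2*i) (2*(m+L)+1) by omega)
    exact Or.inr ⟨j, by omega⟩

lemma not_cr_w (D m L n : ℕ) (hD : 1 ≤ D) (hL : 2 ≤ L) (hm : D + 1 ≤ m) (hmL : m ≤ D*L)
    (hn : n + 1 = m + L) : ¬ Cr (D+2) (L+1) n (dbl (ww D m) n) := by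
  rintro ⟨-, h2⟩
  have hb := h2 m (by omega)
  have ev : ∀ i, dbl (ww D m) n (2*i) = 0 := fun i => by
    simp only [dbl]; rw [if_neg (by omega)]
  have key0 : vc (dbl (ww D m) n) (2*m) (2*m+1) = 1 := by
    rw [vc, vc_zero _ _ _ le_rfl, ev m]; simp
  have key1 : ∀ t, m + t < n → vc (dbl (ww D m) n) (2*m) (2*(m+t)+1) = t+1 →
      vc (dbl (ww D m) n) (2*m) (2*(m+t)+1+1) = t+2 := by
    intro t ht h1
    have e : dbl (ww D m) n (2*(m+t)+1) = t + 1 := by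
      simp only [dbl]
      rw [if_pos (by omega), show (2*(m+t)+1)/2 = m+t by omega]
      simp [ww]
    rw [vc, e, h1, if_pos (by omega)]
  have key : ∀ t, m + t ≤ n → vc (dbl (ww D m) n) (2*m) (2*(m+t)+1) = t+1 := by
    intro t
    induction t with
    | zero => intro _; exact key0
    | succ t ih =>
      intro ht
      have h1 := ih (by omega)
      have h2 := key1 t (by omega) h1
      rw [show 2*(m+(t+1))+1 = 2*(m+t)+1+1+1 by omega, vc, h2,
        show 2*(m+t)+1+1 = 2*(m+t+1) by omega, ev, if_neg (by omega)]
  rcases hb with ⟨B, hB⟩ | ⟨j, hj⟩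
  · rw [path _ _ _ _ le_rfl, cnt_dbl _ _ _ _ le_rfl] at hB
    have o := ones_w D m hD hm (min (B/2) n)
    by_cases hB2 : B ≤ 2*m+1
    · rw [if_neg (by omega)] at o
      split_ifs at hB <;> omega
    · have v1 := key1 0 (by omega) key0
      have v2 := vc_mono (dbl (ww D m) n) (2*m) (show 2*(m+0)+1+1 ≤ B by omega)
      rw [if_neg (by omega)] at hB
      split_ifs at o <;> omega
  · have hj2 : j ≤ 2*n := by
      by_contra hx
      have hz : hs (dbl (ww D m) n) (2*m) j ≠ 0 := by omega
      rw [hs_ne_zero] at hz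
      rcases hz with hz | hz
      · apply hz
        simp only [dbl]; rw [if_neg (by omega)]
      · omega
    have v1 := key (n - m) (by omega)
    rw [show m + (n - m) = n by omega] at v1
    have v2 := vc_mono (dbl (ww D m) n) (2*m) (show j + 1 ≤ 2*n+1 by omega)
    rw [v1, vc] at v2
    have nb : dbl (ww D m) n j ≤ L := by
      by_contra hx
      exact notbad_w D m L n hD hm hmL (by omega) (Or.inr ⟨j, by omega⟩)
    simp only [hs] at hj
    split_ifs at hj v2 <;> omega

lemma main (k l : ℕ) (hk : 3 ≤ k) (hl : 3 ≤ l)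
    (n : ℕ) (h1 : k + l - 3 ≤ n) (h2 : n < (k - 1) * (l - 1)) :
    Nat.card {σ : Equiv.Perm (Fin n) // RightCrucial k l n ⇑σ} <
      Nat.card {σ : Equiv.Perm (Fin (n + 1)) // RightCrucial k l (n + 1) ⇑σ} := by
  classical
  have ex : ∀ x : {σ : Equiv.Perm (Fin n) // RightCrucial k l n ⇑σ},
      ∃ y : {σ : Equiv.Perm (Fin (n + 1)) // RightCrucial k l (n + 1) ⇑σ},
        (∀ j, j ≠ 2*n+1 → Pw y.1 j = Pw x.1 j) ∧ ∀ i < n, Qw y.1 i = Qw x.1 i := by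
    rintro ⟨σ, hσ⟩
    rw [rightCrucial_iff σ k l (by omega)] at hσ
    obtain ⟨c, ⟨a1, a2, a3, a4, a5⟩, hc⟩ := step hk hl h2 (dat_perm σ) hσ
    obtain ⟨τ, b1, b2⟩ := exists_perm (n+1) _ _ a1 a2 a3 a4 a5
    refine ⟨⟨τ, ?_⟩, ?_, ?_⟩
    · rw [rightCrucial_iff τ k l (by omega), b1]; exact hc
    · intro j hj
      simp only [b1]
      exact Function.update_of_ne hj _ _
    · intro i hi
      simp only [b2 i (by omega)]
      exact Function.update_of_ne (by omega) _ _
  have zero : ∀ σ : Equiv.Perm (Fin n), Pw σ (2*n+1) = 0 := fun σ => by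
    by_contra hx
    have := (Pw_supp σ _).1 hx
    omega
  choose F hF1 hF2 using ex
  have inj : Function.Injective F := by
    intro x y hxy
    apply Subtype.ext
    apply perm_inj
    · funext j
      by_cases hj : j = 2*n+1
      · subst hj; rw [zero, zero]
      · rw [← hF1 x j hj, ← hF1 y j hj, hxy]
    · intro i hi
      rw [← hF2 x i hi, ← hF2 y i hi, hxy]
  have nsurj : ¬ Function.Surjective F := by
    intro hs
    obtain ⟨D, rfl⟩ : ∃ D, k = D + 2 := ⟨k - 2, by omega⟩
    obtain ⟨L, rfl⟩ : ∃ L, l = L + 1 := ⟨l - 1, by omega⟩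
    obtain ⟨m, hm⟩ : ∃ m, n + 1 = m + L := ⟨n + 1 - L, by omega⟩
    have hmL : m ≤ D * L := by
      have e : (D + 2 - 1) * (L + 1 - 1) = D * L + L := by
        rw [show D + 2 - 1 = D + 1 by omega, show L + 1 - 1 = L by omega]; ring
      omega
    obtain ⟨a1, a2, a3, a4, a5⟩ := dat_w D m (n+1) (by omega)
    obtain ⟨τ, b1, b2⟩ := exists_perm (n+1) _ _ a1 a2 a3 a4 a5
    have hτ : RightCrucial (D+2) (L+1) (n+1) τ := by
      rw [rightCrucial_iff τ _ _ (by omega), b1, hm]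
      exact cr_w D m L (by omega) (by omega) hmL
    obtain ⟨x, hx⟩ := hs ⟨τ, hτ⟩
    have hP : Pw x.1 = dbl (ww D m) n := by
      funext j
      by_cases hj : j = 2*n+1
      · subst hj; rw [zero]; simp only [dbl]; rw [if_neg (by omega)]
      · rw [← hF1 x j hj, hx]
        simp only [b1, dbl]
        by_cases c : j % 2 = 1 ∧ j < 2*n
        · rw [if_pos c, if_pos (by omega)]
        · rw [if_neg c, if_neg (by omega)]
    have hxc := x.2
    rw [rightCrucial_iff x.1 _ _ (by omega), hP] at hxc
    exact not_cr_w D m L n (by omega) (by omega) (by omega) hmL hm hxc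
  haveI := Fintype.ofFinite {σ : Equiv.Perm (Fin n) // RightCrucial k l n ⇑σ}
  haveI := Fintype.ofFinite {σ : Equiv.Perm (Fin (n+1)) // RightCrucial k l (n+1) ⇑σ}
  rw [Nat.card_eq_fintype_card, Nat.card_eq_fintype_card]
  exact Fintype.card_lt_of_injective_not_surjective F inj nsurj

end CrucialAux

/-- monotonicity for crucial permutations: for `k+l-3 ≤ n < (k-1)(l-1)`,
the number of `(k,l)`-right-crucial permutations of length `n` is strictly smaller than
the number of those of length `n+1`. -/
theorem crucial_count_strict_mono (k l : ℕ) (hk : 3 ≤ k) (hl : 3 ≤ l)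
    (n : ℕ) (h1 : k + l - 3 ≤ n) (h2 : n < (k - 1) * (l - 1)) :
    Nat.card {σ : Equiv.Perm (Fin n) // RightCrucial k l n ⇑σ} <
      Nat.card {σ : Equiv.Perm (Fin (n + 1)) // RightCrucial k l (n + 1) ⇑σ} := by
  exact CrucialAux.main k l hk hl n h1 h2
end

section
/- Let k ≥ ℓ ≥ 3. The number of (k,ℓ)-bicrucial permutations of length k+2ℓ−5 (the minimal possible length of a (k,ℓ)-bicrucial permutation) equals (1+δ_{k,ℓ}) · (k+2ℓ−5)! / ((k+ℓ−3)(k+ℓ−4)(ℓ−1)!(ℓ−2)!(k−3)!), where δ_{k,ℓ} = 1 if k = ℓ and δ_{k,ℓ} = 0 otherwise. -/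
open Finset

def cntW {n : ℕ} (w : Fin n → Fin 3) (a : Fin 3) (t : ℕ) : ℕ :=
  (univ.filter (fun x : Fin n => (x : ℕ) < t ∧ w x = a)).card

def GoodW {n : ℕ} (w : Fin n → Fin 3) : Prop :=
  ∀ j : Fin n, w j ≠ 0 → cntW w 2 j < cntW w 0 j

open Classical in
noncomputable def SW (n u d : ℕ) : ℕ :=
  ∑ w : Fin n → Fin 3, if GoodW w ∧ cntW w 0 n = u ∧ cntW w 2 n = d then 1 else 0

theorem cntW_sum {n : ℕ} (w : Fin n → Fin 3) (a : Fin 3) (t : ℕ) :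
    cntW w a t = ∑ x : Fin n, if (x : ℕ) < t ∧ w x = a then 1 else 0 := by
  unfold cntW; rw [Finset.card_filter]

theorem cntW_snoc_le {n : ℕ} (w : Fin n → Fin 3) (b a : Fin 3) (t : ℕ) (ht : t ≤ n) :
    cntW (Fin.snoc w b : Fin (n+1) → Fin 3) a t = cntW w a t := by
  rw [cntW_sum, cntW_sum, Fin.sum_univ_castSucc]
  simp [Fin.snoc_castSucc, show ¬ n < t by omega]

theorem cntW_snoc_last {n : ℕ} (w : Fin n → Fin 3) (b a : Fin 3) :
    cntW (Fin.snoc w b : Fin (n+1) → Fin 3) a (n+1) = cntW w a n + if b = a then 1 else 0 := by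
  rw [cntW_sum, cntW_sum, Fin.sum_univ_castSucc]
  simp only [Fin.snoc_castSucc, Fin.snoc_last, Fin.val_castSucc, Fin.val_last]
  congr 1
  · apply Finset.sum_congr rfl
    intro x _
    have := x.2
    simp [this, show (x:ℕ) < n + 1 by omega]
  · simp

theorem GoodW_snoc {n : ℕ} (w : Fin n → Fin 3) (b : Fin 3) :
    GoodW (Fin.snoc w b : Fin (n+1) → Fin 3) ↔ GoodW w ∧ (b ≠ 0 → cntW w 2 n < cntW w 0 n) := by
  unfold GoodW
  rw [Fin.forall_fin_succ']
  simp only [Fin.snoc_castSucc, Fin.snoc_last, Fin.val_castSucc, Fin.val_last]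
  rw [cntW_snoc_le _ _ _ _ le_rfl, cntW_snoc_le _ _ _ _ le_rfl]
  refine and_congr (forall_congr' fun j => ?_) Iff.rfl
  rw [cntW_snoc_le _ _ _ _ j.2.le, cntW_snoc_le _ _ _ _ j.2.le]

open Classical in
theorem SW_succ (n u d : ℕ) :
    SW (n+1) u d = (if 1 ≤ u then SW n (u-1) d else 0) + (if d < u then SW n u d else 0)
      + (if 1 ≤ d ∧ d ≤ u then SW n u (d-1) else 0) := by
  unfold SW
  rw [← (Fin.snocEquiv (fun _ : Fin (n+1) => Fin 3)).sum_comp, Fintype.sum_prod_type,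
    Fin.sum_univ_three]
  simp only [Fin.snocEquiv, Equiv.coe_fn_mk, GoodW_snoc, cntW_snoc_last]
  congr 1
  · congr 1
    · by_cases h : 1 ≤ u
      · rw [if_pos h]
        refine Finset.sum_congr rfl fun w _ => ?_
        refine if_congr ?_ rfl rfl
        simp; intro _; omega
      · rw [if_neg h]
        refine Finset.sum_eq_zero fun w _ => ?_
        rw [if_neg]; simp; intro _; omega
    · by_cases h : d < u
      · rw [if_pos h]
        refine Finset.sum_congr rfl fun w _ => ?_
        refine if_congr ?_ rfl rfl
        simp; grind
      · rw [if_neg h]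
        refine Finset.sum_eq_zero fun w _ => ?_
        rw [if_neg]; simp; grind
  · by_cases h : 1 ≤ d ∧ d ≤ u
    · rw [if_pos h]
      refine Finset.sum_congr rfl fun w _ => ?_
      refine if_congr ?_ rfl rfl
      simp; grind
    · rw [if_neg h]
      refine Finset.sum_eq_zero fun w _ => ?_
      rw [if_neg]; simp; grind

theorem SW_zero (u d : ℕ) : SW 0 u d = if u = 0 ∧ d = 0 then 1 else 0 := by
  simp [SW, GoodW, cntW, eq_comm]

theorem SW_gt (n : ℕ) : ∀ u d : ℕ, (u < d ∨ n < u + d) → SW n u d = 0 := by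
  induction n with
  | zero => intro u d h; rw [SW_zero, if_neg]; omega
  | succ n ih =>
    intro u d h
    rw [SW_succ, ite_eq_right_iff.2, ite_eq_right_iff.2, ite_eq_right_iff.2]
    · intro h'; apply ih; omega
    · intro h'; apply ih; omega
    · intro h'; apply ih; omega

theorem SW_zz (n : ℕ) : SW n 0 0 = if n = 0 then 1 else 0 := by
  cases n with
  | zero => simp [SW_zero]
  | succ n => simp [SW_succ]

noncomputable def GW (h d q : ℕ) : ℚ :=
  ((2 * d + h + q).factorial : ℚ) * (h * (d + h + q) + d + h) /
    ((q.factorial : ℚ) * (d+h).factorial * d.factorial * (d + h + q) * (d + h + q + 1))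

theorem GW_10 (q : ℕ) : GW 1 0 q = 1 := by
  unfold GW
  have : ((q.factorial : ℕ) : ℚ) ≠ 0 := by positivity
  simp only [show 2 * 0 + 1 + q = q + 1 by ring, Nat.factorial_succ]
  push_cast
  simp
  field_simp
  ring

theorem GW_rec0 (d q : ℕ) : GW 0 (d+1) q = GW 1 d q := by
  unfold GW
  simp only [show 2 * (d+1) + 0 + q = (2 * d + 1 + q) + 1 by ring, show d + 1 + 0 = d + 1 by ring,
    Nat.factorial_succ (2*d+1+q), Nat.factorial_succ d]
  have : ((q.factorial : ℕ) : ℚ) ≠ 0 := by positivity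
  have : ((d.factorial : ℕ) : ℚ) ≠ 0 := by positivity
  push_cast
  have : (d:ℚ)+1 ≠ 0 := by positivity
  have : (d:ℚ)+1+q ≠ 0 := by positivity
  have : (d:ℚ)+1+q+1 ≠ 0 := by positivity
  field_simp
  ring

theorem GW_rec (h d q : ℕ) (H : 1 ≤ h + d) : GW (h+1) d q = GW h d q +
    (if 1 ≤ d then GW (h+2) (d-1) q else 0) + (if 1 ≤ q then GW (h+1) d (q-1) else 0) := by
  rcases d with _ | d <;> rcases q with _ | q
  · obtain ⟨h, rfl⟩ : ∃ x, h = x + 1 := ⟨h - 1, by omega⟩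
    simp [GW, Nat.factorial_succ]
    field_simp
  · obtain ⟨h, rfl⟩ : ∃ x, h = x + 1 := ⟨h - 1, by omega⟩
    simp [GW]
    simp only [show h + 1 + 1 + (q+1) = h + q + 1 + 1 + 1 by ring, show h + 1 + (q+1) = h + q + 1 + 1 by ring, show h + 1 + 1 + q = h + q + 1 + 1 by ring, Nat.factorial_succ]
    push_cast
    field_simp
    ring
  · simp [GW]
    simp only [show 2 * (d+1) + (h+1) = 2 * d + h + 1 + 1 + 1 by ring, show 2 * (d+1) + h = 2 * d + h + 1 + 1 by ring, show 2 * d + (h+2) = 2 * d + h + 1 + 1 by ring, show d + 1 + (h+1) = d + h + 1 + 1 by ring,  show d + 1 + h = d + h + 1 by ring,  show d + (h+2) = d + h + 1 + 1 by ring, Nat.factorial_succ]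
    push_cast
    field_simp
    ring
  · simp [GW]
    simp only [show 2 * (d+1) + (h+1) + (q+1) = 2 * d + h + q + 1 + 1 + 1 + 1 by ring, show 2 * (d+1) + h + (q+1)= 2 * d + h +q+ 1 + 1 + 1 by ring, show 2 * d + (h+2) +(q+1) = 2 * d + h +q+ 1 + 1 + 1 by ring, show 2 * (d+1) + (h+1) + q = 2 * d + h + q + 1 + 1 + 1 by ring, show d + 1 + (h+1) = d + h + 1 + 1 by ring,  show d + 1 + h = d + h + 1 by ring,  show d + (h+2) = d + h + 1 + 1 by ring, Nat.factorial_succ]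
    push_cast
    field_simp
    ring

theorem SW_eq (n : ℕ) : ∀ h d q : ℕ, 2 * d + h + q = n → 1 ≤ h + d →
    (SW n (d+h) d : ℚ) = GW h d q := by
  induction n with
  | zero => intros; omega
  | succ n ih =>
    intro h d q hn hd
    rw [SW_succ]
    rcases h with _ | h
    · obtain ⟨d, rfl⟩ : ∃ x, d = x + 1 := ⟨d - 1, by omega⟩
      have h0 : SW n d (d+1) = 0 := SW_gt _ _ _ (by omega)
      rw [GW_rec0, ← ih 1 d q (by omega) (by omega)]
      simp [h0]
    · rcases Nat.eq_zero_or_pos (h + d) with h1 | h1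
      · obtain ⟨rfl, rfl⟩ : h = 0 ∧ d = 0 := by omega
        simp [SW_zz]
        rw [GW_10]
        rcases n with _ | n
        · simp [SW_zero]
        · have := ih 1 0 n (by omega) (by omega)
          rw [GW_10] at this
          simp at this
          simp [this]
      · rw [GW_rec _ _ _ h1]
        rw [← ih h d q (by omega) h1]
        have e1 : d + (h+1) - 1 = d + h := by omega
        rw [if_pos (show 1 ≤ d + (h+1) by omega), if_pos (show d < d + (h+1) by omega), e1]
        have a2 : ((if 1 ≤ d ∧ d ≤ d + (h+1) then SW n (d+(h+1)) (d-1) else 0 : ℕ) : ℚ) =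
            if 1 ≤ d then GW (h+2) (d-1) q else 0 := by
          by_cases hd : 1 ≤ d
          · rw [if_pos ⟨hd, by omega⟩, if_pos hd, ← ih (h+2) (d-1) q (by omega) (by omega)]
            congr 2; omega
          · rw [if_neg (by omega), if_neg hd]; simp
        have a3 : (SW n (d+(h+1)) d : ℚ) = if 1 ≤ q then GW (h+1) d (q-1) else 0 := by
          by_cases hq : 1 ≤ q
          · rw [if_pos hq, ← ih (h+1) d (q-1) (by omega) (by omega)]
          · rw [if_neg hq]
            rw [SW_gt _ _ _ (by omega)]; simp
        push_cast at a2 ⊢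
        rw [a3, a2]; ring

theorem SW_final (m q : ℕ) (hm : 1 ≤ m) :
    SW (2 * m + q) m m * ((m + q + 1) * (m + q) * m.factorial * (m-1).factorial * q.factorial) =
      (2 * m + q).factorial := by
  obtain ⟨m, rfl⟩ : ∃ x, m = x + 1 := ⟨m - 1, by omega⟩
  have := SW_eq (2 * (m+1) + q) 0 (m+1) q (by omega) (by omega)
  unfold GW at this
  have e : (2 * (m+1) + 0 + q) = 2 * (m+1) + q := by ring
  simp only [e, Nat.add_zero] at this
  have h2 : (SW (2 * (m+1) + q) (m+1) (m+1) * ((m + 1 + q + 1) * (m + 1 + q) * (m+1).factorial * m.factorial * q.factorial) : ℚ) =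
      (2 * (m+1) + q).factorial := by
    rw [this]
    simp only [Nat.factorial_succ m]
    push_cast
    field_simp
    ring
  exact_mod_cast h2

theorem card_range_perm {n : ℕ} (σ : Equiv.Perm (Fin n)) (a b : ℕ) (hb : b ≤ n) :
    (univ.filter (fun x : Fin n => a ≤ (σ x : ℕ) ∧ (σ x : ℕ) < b)).card = b - a := by
  rw [← Nat.card_Ico]
  refine Finset.card_bij (fun x _ => (σ x : ℕ)) ?_ ?_ ?_
  · intro x hx; simpa using hx
  · intro x _ y _ h; exact σ.injective (Fin.ext h)
  · intro v hv
    rw [Finset.mem_Ico] at hv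
    refine ⟨σ.symm ⟨v, by omega⟩, ?_, ?_⟩ <;> simp [hv.1, hv.2]

def ltr (m q : ℕ) {n : ℕ} (v : Fin n) : Fin 3 :=
  if (v : ℕ) < m then 0 else if (v : ℕ) < m + q then 1 else 2

theorem ltr_zero {m q n : ℕ} (v : Fin n) : ltr m q v = 0 ↔ (v : ℕ) < m := by
  unfold ltr; split_ifs <;> simp_all
theorem ltr_one {m q n : ℕ} (v : Fin n) : ltr m q v = 1 ↔ m ≤ (v : ℕ) ∧ (v : ℕ) < m + q := by
  unfold ltr; split_ifs <;> simp_all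
theorem ltr_two {m q n : ℕ} (v : Fin n) : ltr m q v = 2 ↔ m + q ≤ (v : ℕ) := by
  unfold ltr; split_ifs <;> simp_all; omega

structure Fam (m q n : ℕ) (σ : Fin n → Fin n) : Prop where
  low : ∀ x y, x < y → (σ x : ℕ) < m → (σ y : ℕ) < m → σ y < σ x
  mid : ∀ x y, x < y → m ≤ (σ x : ℕ) → (σ x : ℕ) < m + q → m ≤ (σ y : ℕ) →
    (σ y : ℕ) < m + q → σ x < σ y
  high : ∀ x y, x < y → m + q ≤ (σ x : ℕ) → m + q ≤ (σ y : ℕ) → σ y < σ x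
  good : GoodW (fun x => ltr m q (σ x))

theorem Fam_val0 {m q n : ℕ} (hn : n = 2 * m + q) (σ : Equiv.Perm (Fin n)) (h : Fam m q n σ)
    (j : Fin n) (hj : (σ j : ℕ) < m) :
    (σ j : ℕ) + cntW (fun x => ltr m q (σ x)) 0 j + 1 = m := by
  have := card_range_perm σ (σ j + 1) m (by omega)
  have e : cntW (fun x => ltr m q (σ x)) 0 j = m - (σ j + 1) := by
    rw [← this, cntW]
    congr 1
    ext x
    simp only [mem_filter, mem_univ, true_and, ltr_zero]
    constructor
    · rintro ⟨h1, h2⟩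
      have := h.low x j h1 h2 hj
      exact ⟨this, h2⟩
    · rintro ⟨h1, h2⟩
      refine ⟨?_, h2⟩
      rcases lt_trichotomy x j with h3 | h3 | h3
      · exact h3
      · subst h3; omega
      · have := h.low j x h3 hj h2
        have : (σ x : ℕ) < σ j := this
        omega
  omega

theorem Fam_val1 {m q n : ℕ} (hn : n = 2 * m + q) (σ : Equiv.Perm (Fin n)) (h : Fam m q n σ)
    (j : Fin n) (hj : m ≤ (σ j : ℕ)) (hj' : (σ j : ℕ) < m + q) :
    (σ j : ℕ) = m + cntW (fun x => ltr m q (σ x)) 1 j := by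
  have := card_range_perm σ m (σ j) (by omega)
  have e : cntW (fun x => ltr m q (σ x)) 1 j = (σ j) - m := by
    rw [← this, cntW]
    congr 1
    ext x
    simp only [mem_filter, mem_univ, true_and, ltr_one]
    constructor
    · rintro ⟨h1, h2, h3⟩
      have := h.mid x j h1 h2 h3 hj hj'
      exact ⟨h2, this⟩
    · rintro ⟨h1, h2⟩
      refine ⟨?_, h1, by omega⟩
      rcases lt_trichotomy x j with h3 | h3 | h3
      · exact h3
      · subst h3; omega
      · have := h.mid j x h3 hj hj' h1 (by omega)
        have : (σ j : ℕ) < σ x := this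
        omega
  omega

theorem Fam_val2 {m q n : ℕ} (σ : Equiv.Perm (Fin n)) (h : Fam m q n σ)
    (j : Fin n) (hj : m + q ≤ (σ j : ℕ)) :
    (σ j : ℕ) + cntW (fun x => ltr m q (σ x)) 2 j + 1 = n := by
  have := card_range_perm σ (σ j + 1) n le_rfl
  have e : cntW (fun x => ltr m q (σ x)) 2 j = n - (σ j + 1) := by
    rw [← this, cntW]
    congr 1
    ext x
    simp only [mem_filter, mem_univ, true_and, ltr_two]
    constructor
    · rintro ⟨h1, h2⟩
      have := h.high x j h1 h2 hj
      exact ⟨this, (σ x).2⟩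
    · rintro ⟨h1, h2⟩
      refine ⟨?_, by omega⟩
      rcases lt_trichotomy x j with h3 | h3 | h3
      · exact h3
      · subst h3; omega
      · have := h.high j x h3 hj (by omega)
        have : (σ x : ℕ) < σ j := this
        omega
  omega

theorem cnt_low {m q n : ℕ} (hn : n = 2 * m + q) (σ : Equiv.Perm (Fin n)) :
    (univ.filter (fun x : Fin n => (σ x : ℕ) < m)).card = m := by
  simpa using card_range_perm σ 0 m (by omega)

theorem cnt_high {m q n : ℕ} (hn : n = 2 * m + q) (σ : Equiv.Perm (Fin n)) :
    (univ.filter (fun x : Fin n => m + q ≤ (σ x : ℕ))).card = m := by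
  have := card_range_perm σ (m+q) n le_rfl
  simp only [Fin.is_lt, and_true] at this
  omega

theorem cnt_mid {m q n : ℕ} (hn : n = 2 * m + q) (σ : Equiv.Perm (Fin n)) :
    (univ.filter (fun x : Fin n => m ≤ (σ x : ℕ) ∧ (σ x : ℕ) < m + q)).card = q := by
  have := card_range_perm σ m (m+q) (by omega)
  omega

theorem cntW_lt {n : ℕ} (w : Fin n → Fin 3) (x y : Fin n) (a : Fin 3) (hx : w x = a) (h : x < y) :
    cntW w a x < cntW w a y := by
  apply Finset.card_lt_card
  rw [Finset.ssubset_iff_of_subset]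
  · refine ⟨x, ?_, ?_⟩
    · simpa [hx] using h
    · simp
  · intro z
    simp only [mem_filter, mem_univ, true_and]
    rintro ⟨h1, h2⟩
    exact ⟨by have : (x:ℕ) < y := h
              omega, h2⟩

theorem cntW_lt_n {n : ℕ} (w : Fin n → Fin 3) (x : Fin n) :
    cntW w (w x) x < cntW w (w x) n := by
  apply Finset.card_lt_card
  rw [Finset.ssubset_iff_of_subset]
  · refine ⟨x, ?_, ?_⟩
    · simp
    · simp
  · intro z
    simp only [mem_filter, mem_univ, true_and]
    rintro ⟨h1, h2⟩
    exact ⟨z.2, h2⟩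

theorem cntW_total {n : ℕ} (w : Fin n → Fin 3) :
    cntW w 0 n + cntW w 1 n + cntW w 2 n = n := by
  simp only [cntW_sum, Fin.is_lt, true_and]
  rw [← Finset.sum_add_distrib, ← Finset.sum_add_distrib]
  rw [Finset.sum_congr rfl (g := fun _ => 1)]
  · simp
  · intro x _
    generalize w x = a
    fin_cases a <;> simp

def valW (m q : ℕ) {n : ℕ} (w : Fin n → Fin 3) (j : Fin n) : ℕ :=
  if w j = 0 then m - 1 - cntW w 0 j else if w j = 1 then m + cntW w 1 j else n - 1 - cntW w 2 j

theorem fin3 (a : Fin 3) : a = 0 ∨ a = 1 ∨ a = 2 := by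
  fin_cases a <;> simp

theorem valW0 {m q n : ℕ} (w : Fin n → Fin 3)
    (h0 : cntW w 0 n = m) (j : Fin n) (hj : w j = 0) :
    valW m q w j + cntW w 0 j + 1 = m := by
  have := cntW_lt_n w j
  rw [hj] at this
  simp only [valW, hj, if_true]; omega

theorem valW1 {m q n : ℕ} (hn : n = 2 * m + q) (w : Fin n → Fin 3)
    (h0 : cntW w 0 n = m) (h2 : cntW w 2 n = m) (j : Fin n) (hj : w j = 1) :
    valW m q w j = m + cntW w 1 j ∧ cntW w 1 j < q := by
  have h3 := cntW_lt_n w j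
  have := cntW_total w
  rw [hj] at h3
  simp [valW, hj]; omega

theorem valW2 {m q n : ℕ} (w : Fin n → Fin 3)
    (h2 : cntW w 2 n = m) (j : Fin n) (hj : w j = 2) :
    valW m q w j + cntW w 2 j + 1 = n ∧ cntW w 2 j < m := by
  have h3 := cntW_lt_n w j
  have := cntW_total w
  rw [hj] at h3
  simp [valW, hj]; omega

theorem exists_Fam {m q n : ℕ} (hn : n = 2 * m + q) (w : Fin n → Fin 3) (hg : GoodW w)
    (h0 : cntW w 0 n = m) (h2 : cntW w 2 n = m) :
    ∃ σ : Equiv.Perm (Fin n), Fam m q n σ ∧ (fun x => ltr m q (σ x)) = w := by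
  have hlt : ∀ j, valW m q w j < n := by
    intro j
    rcases fin3 (w j) with h | h | h
    · have := valW0 (q := q) w h0 j h; omega
    · have := valW1 hn w h0 h2 j h; omega
    · have := valW2 (q := q) w h2 j h; omega
  have hl : ∀ j, ltr m q (⟨valW m q w j, hlt j⟩ : Fin n) = w j := by
    intro j
    rcases fin3 (w j) with h | h | h
    · have := valW0 (q := q) w h0 j h
      rw [h, ltr_zero]; simp only; omega
    · have := valW1 hn w h0 h2 j h
      rw [h, ltr_one]; simp only; omega
    · have := valW2 (q := q) w h2 j h
      rw [h, ltr_two]; simp only; omega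
  have hinj : Function.Injective (fun j => (⟨valW m q w j, hlt j⟩ : Fin n)) := by
    intro x y hxy
    have hv : valW m q w x = valW m q w y := by simpa using hxy
    have hw : w x = w y := by rw [← hl x, ← hl y]; exact congrArg _ hxy
    have hc : cntW w (w x) x = cntW w (w x) y := by
      rcases fin3 (w x) with h | h | h
      · have := valW0 (q := q) w h0 x h
        have := valW0 (q := q) w h0 y (hw ▸ h)
        rw [h]; omega
      · have := valW1 hn w h0 h2 x h
        have := valW1 hn w h0 h2 y (hw ▸ h)
        rw [h]; omega
      · have := valW2 (q := q) w h2 x h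
        have := valW2 (q := q) w h2 y (hw ▸ h)
        rw [h]; omega
    rcases lt_trichotomy x y with h | h | h
    · have := cntW_lt w x y (w x) rfl h; omega
    · exact h
    · have := cntW_lt w y x (w x) hw.symm h; omega
  let σ : Equiv.Perm (Fin n) := Equiv.ofBijective _ (Finite.injective_iff_bijective.1 hinj)
  have hσ : ∀ j, σ j = ⟨valW m q w j, hlt j⟩ := fun j => rfl
  have hw : (fun x => ltr m q (σ x)) = w := by
    funext x; rw [hσ, hl]
  refine ⟨σ, ⟨?_, ?_, ?_, ?_⟩, hw⟩
  · intro x y hxy hx hy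
    rw [← ltr_zero (q := q), hσ, hl] at hx hy
    rw [hσ, hσ, Fin.mk_lt_mk]
    have := valW0 (q := q) w h0 x hx
    have := valW0 (q := q) w h0 y hy
    have := cntW_lt w x y 0 hx hxy
    omega
  · intro x y hxy hx hx' hy hy'
    have hx := (ltr_one _).2 ⟨hx, hx'⟩
    have hy := (ltr_one _).2 ⟨hy, hy'⟩
    rw [hσ, hl] at hx hy
    rw [hσ, hσ, Fin.mk_lt_mk]
    have := valW1 hn w h0 h2 x hx
    have := valW1 hn w h0 h2 y hy
    have := cntW_lt w x y 1 hx hxy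
    omega
  · intro x y hxy hx hy
    rw [← ltr_two, hσ, hl] at hx hy
    rw [hσ, hσ, Fin.mk_lt_mk]
    have := valW2 (q := q) w h2 x hx
    have := valW2 (q := q) w h2 y hy
    have := cntW_lt w x y 2 hx hxy
    omega
  · rw [hw]; exact hg

theorem Fam_card {m q n : ℕ} (hn : n = 2 * m + q) :
    Nat.card {σ : Equiv.Perm (Fin n) // Fam m q n σ} = SW n m m := by
  classical
  have : SW n m m = Nat.card {w : Fin n → Fin 3 // GoodW w ∧ cntW w 0 n = m ∧ cntW w 2 n = m} := by
    rw [SW, Nat.card_eq_fintype_card, Fintype.card_subtype, Finset.card_filter]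
  rw [this]
  refine Nat.card_congr (Equiv.ofBijective (fun σ => ⟨fun x => ltr m q (σ.1 x), σ.2.good, ?_, ?_⟩) ⟨?_, ?_⟩)
  · simp only [cntW, Fin.is_lt, true_and, ltr_zero]
    exact cnt_low hn σ.1
  · simp only [cntW, Fin.is_lt, true_and, ltr_two]
    exact cnt_high hn σ.1
  · rintro ⟨σ, hσ⟩ ⟨τ, hτ⟩ h
    have h : (fun x => ltr m q (σ x)) = (fun x => ltr m q (τ x)) := congrArg Subtype.val h
    apply Subtype.ext
    apply Equiv.ext
    intro j
    apply Fin.ext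
    have hj := congrFun h j
    simp only at hj ⊢
    rcases fin3 (ltr m q (σ j)) with h1 | h1 | h1
    · have h2 := h1
      rw [hj] at h2
      rw [ltr_zero] at h1 h2
      have a1 := Fam_val0 hn σ hσ j h1
      have a2 := Fam_val0 hn τ hτ j h2
      rw [h] at a1; omega
    · have h2 := h1
      rw [hj] at h2
      rw [ltr_one] at h1 h2
      have a1 := Fam_val1 hn σ hσ j h1.1 h1.2
      have a2 := Fam_val1 hn τ hτ j h2.1 h2.2
      rw [h] at a1; omega
    · have h2 := h1
      rw [hj] at h2
      rw [ltr_two] at h1 h2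
      have a1 := Fam_val2 σ hσ j h1
      have a2 := Fam_val2 τ hτ j h2
      rw [h] at a1; omega
  · rintro ⟨w, hg, h0, h2⟩
    obtain ⟨σ, hσ, hw⟩ := exists_Fam hn w hg h0 h2
    exact ⟨⟨σ, hσ⟩, Subtype.ext hw⟩

theorem hasIncr_iff (k n : ℕ) (σ : Fin n → Fin n) :
    HasIncr k n σ ↔ ∃ s : Finset (Fin n), s.card = k ∧ StrictMonoOn σ s := by
  constructor
  · rintro ⟨f, hf, hs⟩
    refine ⟨univ.map ⟨f, hf.injective⟩, by simp, ?_⟩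
    intro x hx y hy hxy
    simp only [coe_map, Function.Embedding.coeFn_mk, coe_univ, Set.image_univ, Set.mem_range] at hx hy
    obtain ⟨a, rfl⟩ := hx
    obtain ⟨b, rfl⟩ := hy
    exact hs (hf.lt_iff_lt.1 hxy)
  · rintro ⟨s, hs, hm⟩
    refine ⟨s.orderEmbOfFin hs, (s.orderEmbOfFin hs).strictMono, ?_⟩
    intro a b hab
    exact hm (s.orderEmbOfFin_mem hs a) (s.orderEmbOfFin_mem hs b)
      ((s.orderEmbOfFin hs).strictMono hab)

theorem hasDecr_iff' (k n : ℕ) (σ : Fin n → Fin n) :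
    HasDecr k n σ ↔ HasIncr k n (fun x => (σ x).rev) := by
  unfold HasIncr HasDecr
  refine exists_congr fun f => and_congr Iff.rfl ?_
  constructor
  · intro h a b hab
    exact Fin.rev_lt_rev.2 (h hab)
  · intro h a b hab
    exact Fin.rev_lt_rev.1 (h hab)

theorem anti_iff {n : ℕ} (σ : Fin n → Fin n) (s : Set (Fin n)) :
    StrictMonoOn (fun x => (σ x).rev) s ↔ StrictAntiOn σ s := by
  constructor
  · intro h a ha b hb hab
    exact Fin.rev_lt_rev.1 (h ha hb hab)
  · intro h a ha b hb hab
    exact Fin.rev_lt_rev.2 (h ha hb hab)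

theorem mono_iff {n : ℕ} (σ : Fin n → Fin n) (s : Set (Fin n)) :
    StrictAntiOn (fun x => (σ x).rev) s ↔ StrictMonoOn σ s := by
  constructor
  · intro h a ha b hb hab
    exact Fin.rev_lt_rev.1 (h ha hb hab)
  · intro h a ha b hb hab
    exact Fin.rev_lt_rev.2 (h ha hb hab)

theorem hasDecr_iff (k n : ℕ) (σ : Fin n → Fin n) :
    HasDecr k n σ ↔ ∃ s : Finset (Fin n), s.card = k ∧ StrictAntiOn σ s := by
  rw [hasDecr_iff', hasIncr_iff]
  simp only [anti_iff]

theorem ext_incr {n k : ℕ} (σ : Fin n → Fin n) (τ : Fin (n+1) → Fin (n+1)) (p i : Fin (n+1))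
    (hτ : ∀ x, τ (p.succAbove x) = i.succAbove (σ x)) (hp : τ p = i)
    (hno : ¬ HasIncr (k+1) n σ) :
    HasIncr (k+1) (n+1) τ ↔ ∃ s : Finset (Fin n), s.card = k ∧ StrictMonoOn σ s ∧
      ∀ x ∈ s, (p.succAbove x < p ↔ i.succAbove (σ x) < i) := by
  rw [hasIncr_iff] at *
  constructor
  · rintro ⟨T, hT, hm⟩
    let s : Finset (Fin n) := univ.filter (fun x => p.succAbove x ∈ T)
    have hs : s.map p.succAboveEmb = T.erase p := by
      ext y
      simp only [s, mem_map, mem_filter, mem_univ, true_and, mem_erase, Fin.succAboveEmb_apply]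
      constructor
      · rintro ⟨x, hx, rfl⟩
        exact ⟨Fin.succAbove_ne p x, hx⟩
      · rintro ⟨h1, h2⟩
        obtain ⟨x, rfl⟩ := Fin.exists_succAbove_eq h1
        exact ⟨x, h2, rfl⟩
    have hsm : StrictMonoOn σ s := by
      intro x hx y hy hxy
      have hx' : p.succAbove x ∈ T := by simpa [s] using hx
      have hy' : p.succAbove y ∈ T := by simpa [s] using hy
      have := hm hx' hy' ((Fin.strictMono_succAbove p) hxy)
      rw [hτ, hτ] at this
      exact (Fin.strictMono_succAbove i).lt_iff_lt.1 this
    have hc := congrArg Finset.card hs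
    rw [Finset.card_map] at hc
    by_cases hpT : p ∈ T
    · rw [Finset.card_erase_of_mem hpT, hT] at hc
      refine ⟨s, by simpa using hc, hsm, ?_⟩
      intro x hx
      have hx' : p.succAbove x ∈ T := by simpa [s] using hx
      rw [← hτ, ← hm.lt_iff_lt hx' hpT, hp]
    · rw [Finset.erase_eq_of_notMem hpT, hT] at hc
      exact absurd ⟨s, hc, hsm⟩ hno
  · rintro ⟨s, hs, hm, hx⟩
    refine ⟨insert p (s.map p.succAboveEmb), ?_, ?_⟩
    · rw [Finset.card_insert_of_notMem, Finset.card_map, hs]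
      simp [Fin.succAbove_ne]
    · intro a ha b hb hab
      simp only [coe_insert, coe_map, Set.mem_insert_iff, Set.mem_image, SetLike.mem_coe, Fin.succAboveEmb_apply] at ha hb
      rcases ha with rfl | ⟨x, hxs, rfl⟩ <;> rcases hb with rfl | ⟨y, hys, rfl⟩
      · exact absurd hab (lt_irrefl _)
      · rw [hτ, hp]
        have h1 := hx y hys
        have h2 : ¬ i.succAbove (σ y) < i := by rw [← h1]; exact not_lt.2 hab.le
        exact lt_of_le_of_ne (not_lt.1 h2) (Fin.succAbove_ne _ _).symm
      · rw [hτ, hp]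
        exact (hx x hxs).1 hab
      · rw [hτ, hτ]
        exact (Fin.strictMono_succAbove i) (hm hxs hys ((Fin.strictMono_succAbove p).lt_iff_lt.1 hab))

theorem ext_decr {n k : ℕ} (σ : Fin n → Fin n) (τ : Fin (n+1) → Fin (n+1)) (p i : Fin (n+1))
    (hτ : ∀ x, τ (p.succAbove x) = i.succAbove (σ x)) (hp : τ p = i)
    (hno : ¬ HasDecr (k+1) n σ) :
    HasDecr (k+1) (n+1) τ ↔ ∃ s : Finset (Fin n), s.card = k ∧ StrictAntiOn σ s ∧
      ∀ x ∈ s, (p.succAbove x < p ↔ i < i.succAbove (σ x)) := by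
  rw [hasDecr_iff'] at *
  rw [ext_incr (fun x => (σ x).rev) _ p i.rev _ _ hno]
  · simp only [anti_iff, ← Fin.rev_succAbove, Fin.rev_lt_rev]
  · intro x; simp only [hτ, Fin.rev_succAbove]
  · simp only [hp]

theorem cross {n : ℕ} (σ : Fin n → Fin n) (A B : Finset (Fin n) → Prop)
    (hA : ∀ s, A s → s.Nonempty) (hB : ∀ s, B s → s.Nonempty) :
    (∀ i : Fin (n+1), (∃ s, A s ∧ ∀ x ∈ s, (σ x).castSucc < i) ∨
      (∃ t, B t ∧ ∀ y ∈ t, i ≤ (σ y).castSucc)) ↔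
    ∃ s t, A s ∧ B t ∧ ∀ x ∈ s, ∀ y ∈ t, σ x ≤ σ y := by
  classical
  constructor
  · intro h
    have hex : ∃ i : ℕ, ∃ s, A s ∧ ∀ x ∈ s, (σ x : ℕ) < i := by
      rcases h (Fin.last n) with ⟨s, hs, _⟩ | ⟨t, ht, h1⟩
      · exact ⟨n, s, hs, fun x _ => (σ x).2⟩
      · obtain ⟨y, hy⟩ := hB t ht
        have := h1 y hy
        exact absurd this (not_le.2 (Fin.castSucc_lt_last _))
    obtain ⟨s, hs, hlt⟩ := Nat.find_spec hex
    set i := Nat.find hex with hi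
    obtain ⟨x0, hx0⟩ := hA s hs
    have hi0 : 0 < i := lt_of_le_of_lt (Nat.zero_le _) (hlt x0 hx0)
    have hmin := Nat.find_min hex (m := i - 1) (by omega)
    by_cases hin : i - 1 ≤ n
    · rcases h ⟨i-1, by omega⟩ with ⟨s', hs', h'⟩ | ⟨t, ht, h'⟩
      · exact absurd ⟨s', hs', fun x hx => h' x hx⟩ hmin
      · refine ⟨s, t, hs, ht, fun x hx y hy => ?_⟩
        have h1 := hlt x hx
        have h2 : i - 1 ≤ (σ y : ℕ) := h' y hy
        show (σ x : ℕ) ≤ σ y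
        omega
    · exact absurd ⟨s, hs, fun x hx => by have := (σ x).2; omega⟩ hmin
  · rintro ⟨s, t, hs, ht, h⟩ i
    by_cases hh : ∀ x ∈ s, (σ x).castSucc < i
    · exact Or.inl ⟨s, hs, hh⟩
    · push Not at hh
      obtain ⟨x, hx, hxi⟩ := hh
      refine Or.inr ⟨t, ht, fun y hy => hxi.trans ?_⟩
      exact h x hx y hy

theorem right_iff {K L n : ℕ} (hK : 1 ≤ K) (hL : 1 ≤ L) (σ : Fin n → Fin n) :
    RightCrucial (K+1) (L+1) n σ ↔ AvoidsPat (K+1) (L+1) n σ ∧ ∃ I D : Finset (Fin n),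
      (I.card = K ∧ StrictMonoOn σ I) ∧ (D.card = L ∧ StrictAntiOn σ D) ∧
        ∀ x ∈ I, ∀ y ∈ D, σ x ≤ σ y := by
  unfold RightCrucial
  refine and_congr_right fun hav => ?_
  rw [← cross σ (fun I => I.card = K ∧ StrictMonoOn σ I) (fun D => D.card = L ∧ StrictAntiOn σ D)
    (fun s h => Finset.card_pos.1 (by omega)) (fun s h => Finset.card_pos.1 (by omega))]
  refine forall_congr' fun i => ?_
  unfold ContainsPat
  have hp : (rightExt σ i) (Fin.last n) = i := by simp [rightExt]
  have hτ : ∀ x, (rightExt σ i) ((Fin.last n).succAbove x) = i.succAbove (σ x) := by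
    intro x; simp [rightExt]
  rw [ext_incr σ _ _ i hτ hp hav.1, ext_decr σ _ _ i hτ hp hav.2]
  simp only [Fin.succAbove_last, Fin.castSucc_lt_last, true_iff, Fin.succAbove_lt_iff_castSucc_lt,
    Fin.lt_succAbove_iff_le_castSucc, and_assoc]

theorem left_iff {K L n : ℕ} (hK : 1 ≤ K) (hL : 1 ≤ L) (σ : Fin n → Fin n) :
    LeftCrucial (K+1) (L+1) n σ ↔ AvoidsPat (K+1) (L+1) n σ ∧ ∃ D I : Finset (Fin n),
      (D.card = L ∧ StrictAntiOn σ D) ∧ (I.card = K ∧ StrictMonoOn σ I) ∧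
        ∀ x ∈ D, ∀ y ∈ I, σ x ≤ σ y := by
  unfold LeftCrucial
  refine and_congr_right fun hav => ?_
  rw [← cross σ (fun D => D.card = L ∧ StrictAntiOn σ D) (fun I => I.card = K ∧ StrictMonoOn σ I)
    (fun s h => Finset.card_pos.1 (by omega)) (fun s h => Finset.card_pos.1 (by omega))]
  refine forall_congr' fun i => ?_
  unfold ContainsPat
  have hp : (leftExt σ i) 0 = i := by simp [leftExt]
  have hτ : ∀ x, (leftExt σ i) ((0 : Fin (n+1)).succAbove x) = i.succAbove (σ x) := by
    intro x; simp [leftExt]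
  rw [ext_incr σ _ _ i hτ hp hav.1, ext_decr σ _ _ i hτ hp hav.2, or_comm]
  simp only [Fin.not_lt_zero, false_iff, Fin.succAbove_lt_iff_castSucc_lt,
    Fin.lt_succAbove_iff_le_castSucc, and_assoc, not_lt, not_le]

theorem bicrucial_iff {K L n : ℕ} (hK : 1 ≤ K) (hL : 1 ≤ L) (σ : Fin n → Fin n) :
    Bicrucial (K+1) (L+1) n σ ↔
      (∀ s : Finset (Fin n), StrictMonoOn σ s → s.card ≤ K) ∧
      (∀ s : Finset (Fin n), StrictAntiOn σ s → s.card ≤ L) ∧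
      ∃ I₁ D₁ I₂ D₂ : Finset (Fin n),
      I₁.card = K ∧ StrictMonoOn σ I₁ ∧ D₁.card = L ∧ StrictAntiOn σ D₁ ∧
      I₂.card = K ∧ StrictMonoOn σ I₂ ∧ D₂.card = L ∧ StrictAntiOn σ D₂ ∧
        (∀ x ∈ I₁, ∀ y ∈ D₁, σ x ≤ σ y) ∧ (∀ y ∈ D₂, ∀ x ∈ I₂, σ y ≤ σ x) := by
  have h1 : ¬ HasIncr (K+1) n σ ↔ (∀ s : Finset (Fin n), StrictMonoOn σ s → s.card ≤ K) := by
    rw [hasIncr_iff]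
    constructor
    · intro h s hs
      by_contra hc
      obtain ⟨t, ht, htc⟩ := Finset.exists_subset_card_eq (show K + 1 ≤ s.card by omega)
      exact h ⟨t, htc, hs.mono (by exact_mod_cast ht)⟩
    · rintro h ⟨s, hs, hm⟩
      have := h s hm
      omega
  have h2 : ¬ HasDecr (L+1) n σ ↔ (∀ s : Finset (Fin n), StrictAntiOn σ s → s.card ≤ L) := by
    rw [hasDecr_iff]
    constructor
    · intro h s hs
      by_contra hc
      obtain ⟨t, ht, htc⟩ := Finset.exists_subset_card_eq (show L + 1 ≤ s.card by omega)
      exact h ⟨t, htc, hs.mono (by exact_mod_cast ht)⟩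
    · rintro h ⟨s, hs, hm⟩
      have := h s hm
      omega
  unfold Bicrucial
  rw [right_iff hK hL, left_iff hK hL, ← h1, ← h2]
  unfold AvoidsPat
  constructor
  · rintro ⟨⟨⟨a, b⟩, I₁, D₁, ⟨c1, c2⟩, ⟨c3, c4⟩, c5⟩, -, D₂, I₂, ⟨e1, e2⟩, ⟨e3, e4⟩, e5⟩
    exact ⟨a, b, I₁, D₁, I₂, D₂, c1, c2, c3, c4, e3, e4, e1, e2, c5, e5⟩
  · rintro ⟨a, b, I₁, D₁, I₂, D₂, c1, c2, c3, c4, e3, e4, e1, e2, c5, e5⟩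
    exact ⟨⟨⟨a, b⟩, I₁, D₁, ⟨c1, c2⟩, ⟨c3, c4⟩, c5⟩, ⟨a, b⟩, D₂, I₂, ⟨e1, e2⟩, ⟨e3, e4⟩, e5⟩

theorem cntW_ltr0 {m q n : ℕ} (σ : Fin n → Fin n) (j : Fin n) :
    cntW (fun x => ltr m q (σ x)) 0 j = (univ.filter (fun x => x < j ∧ (σ x : ℕ) < m)).card := by
  simp only [cntW, ltr_zero]; rfl

theorem cntW_ltr2 {m q n : ℕ} (σ : Fin n → Fin n) (j : Fin n) :
    cntW (fun x => ltr m q (σ x)) 2 j =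
      (univ.filter (fun x => x < j ∧ m + q ≤ (σ x : ℕ))).card := by
  simp only [cntW, ltr_two]; rfl

theorem GoodW_ltr {m q n : ℕ} (σ : Fin n → Fin n) :
    GoodW (fun x => ltr m q (σ x)) ↔ ∀ j, m ≤ (σ j : ℕ) →
      (univ.filter (fun x => x < j ∧ m + q ≤ (σ x : ℕ))).card <
      (univ.filter (fun x => x < j ∧ (σ x : ℕ) < m)).card := by
  unfold GoodW
  simp only [cntW_ltr0, cntW_ltr2, ne_eq, ltr_zero, not_lt]

theorem low_split {m q n : ℕ} (hn : n = 2 * m + q) (σ : Equiv.Perm (Fin n)) (j : Fin n)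
    (hj : m ≤ (σ j : ℕ)) :
    (univ.filter (fun x => x < j ∧ (σ x : ℕ) < m)).card +
      (univ.filter (fun x => j < x ∧ (σ x : ℕ) < m)).card = m := by
  conv_rhs => rw [← cnt_low hn σ]
  rw [← Finset.card_union_of_disjoint]
  · congr 1
    ext x
    simp only [mem_union, mem_filter, mem_univ, true_and]
    constructor
    · tauto
    · intro h
      rcases lt_trichotomy x j with h1 | h1 | h1
      · tauto
      · subst h1; omega
      · tauto
  · rw [Finset.disjoint_left]
    intro x
    simp only [mem_filter, mem_univ, true_and]
    rintro ⟨h1, -⟩ ⟨h2, -⟩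
    exact absurd (h1.trans h2) (lt_irrefl _)

theorem Fam_bicrucial {m q n : ℕ} (hn : n = 2 * m + q) (hm : 1 ≤ m) (σ : Equiv.Perm (Fin n))
    (h : Fam m q n σ) : Bicrucial (q+2+1) (m+1) n σ := by
  classical
  have hg := (GoodW_ltr _).1 h.good
  rw [bicrucial_iff (by omega) hm]
  refine ⟨?_, ?_, ?_⟩
  · intro S hS
    have e1 : (S.filter (fun x => (σ x : ℕ) < m)).card ≤ 1 := by
      rw [Finset.card_le_one]
      intro x hx y hy
      rw [mem_filter] at hx hy
      rcases lt_trichotomy x y with h1 | h1 | h1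
      · exact absurd (h.low x y h1 hx.2 hy.2) (hS hx.1 hy.1 h1).not_gt
      · exact h1
      · exact absurd (h.low y x h1 hy.2 hx.2) (hS hy.1 hx.1 h1).not_gt
    have e2 : (S.filter (fun x => m + q ≤ (σ x : ℕ))).card ≤ 1 := by
      rw [Finset.card_le_one]
      intro x hx y hy
      rw [mem_filter] at hx hy
      rcases lt_trichotomy x y with h1 | h1 | h1
      · exact absurd (h.high x y h1 hx.2 hy.2) (hS hx.1 hy.1 h1).not_gt
      · exact h1
      · exact absurd (h.high y x h1 hy.2 hx.2) (hS hy.1 hx.1 h1).not_gt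
    have e3 := cnt_mid hn σ
    have hsub : S ⊆ (S.filter (fun x => (σ x : ℕ) < m) ∪ S.filter (fun x => m + q ≤ (σ x : ℕ))) ∪
        univ.filter (fun x : Fin n => m ≤ (σ x : ℕ) ∧ (σ x : ℕ) < m + q) := by
      intro x hx
      simp only [mem_union, mem_filter, mem_univ, true_and, hx]
      omega
    have := Finset.card_le_card hsub
    have := Finset.card_union_le (S.filter (fun x => (σ x : ℕ) < m) ∪ S.filter (fun x => m + q ≤ (σ x : ℕ))) (univ.filter (fun x : Fin n => m ≤ (σ x : ℕ) ∧ (σ x : ℕ) < m + q))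
    have := Finset.card_union_le (S.filter (fun x => (σ x : ℕ) < m)) (S.filter (fun x => m + q ≤ (σ x : ℕ)))
    omega
  · intro S hS
    by_cases hne : (S.filter (fun x => m ≤ (σ x : ℕ))).Nonempty
    · obtain ⟨j, hj, hmax⟩ := Finset.exists_max_image _ (fun x => x) hne
      rw [mem_filter] at hj
      have hsub : S ⊆ insert j (univ.filter (fun x => x < j ∧ m + q ≤ (σ x : ℕ)) ∪
          univ.filter (fun x => j < x ∧ (σ x : ℕ) < m)) := by
        intro x hx
        simp only [mem_insert, mem_union, mem_filter, mem_univ, true_and]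
        rcases lt_trichotomy x j with h1 | h1 | h1
        · right; left
          refine ⟨h1, ?_⟩
          have h2 : (σ j : ℕ) < σ x := hS hx hj.1 h1
          by_contra hc
          have h3 : (σ x : ℕ) < σ j := h.mid x j h1 (by omega) (by omega) hj.2 (by omega)
          omega
        · left; exact h1
        · right; right
          refine ⟨h1, ?_⟩
          by_contra hc
          exact absurd (hmax x (mem_filter.2 ⟨hx, by omega⟩)) (not_le.2 h1)
      have := Finset.card_le_card hsub
      have := Finset.card_insert_le j (univ.filter (fun x => x < j ∧ m + q ≤ (σ x : ℕ)) ∪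
          univ.filter (fun x => j < x ∧ (σ x : ℕ) < m))
      have := Finset.card_union_le (univ.filter (fun x => x < j ∧ m + q ≤ (σ x : ℕ))) (univ.filter (fun x => j < x ∧ (σ x : ℕ) < m))
      have := hg j hj.2
      have := low_split hn σ j hj.2
      omega
    · rw [Finset.not_nonempty_iff_eq_empty, Finset.filter_eq_empty_iff] at hne
      have := cnt_low hn σ
      rw [← this]
      apply Finset.card_le_card
      intro x hx
      have := hne hx
      simp; omega
  · obtain ⟨a, ha⟩ : ∃ a, (σ a : ℕ) = m + q := ⟨σ.symm ⟨m+q, by omega⟩, by simp⟩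
    obtain ⟨c, hc⟩ : ∃ c, (σ c : ℕ) = m - 1 := ⟨σ.symm ⟨m-1, by omega⟩, by simp⟩
    have hcl : ∀ j, m ≤ (σ j : ℕ) → c < j := by
      intro j hj
      have := hg j hj
      obtain ⟨x, hx⟩ := Finset.card_pos.1 (lt_of_le_of_lt (Nat.zero_le _) this)
      simp only [mem_filter, mem_univ, true_and] at hx
      by_contra hh
      have h1 : (σ c : ℕ) < σ x := h.low x c (lt_of_lt_of_le hx.1 (not_lt.1 hh)) hx.2 (by omega)
      omega
    have hal : ∀ j, m ≤ (σ j : ℕ) → (σ j : ℕ) < m + q → j < a := by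
      intro j hj hj'
      by_contra hh
      have hne : j ≠ a := by rintro rfl; omega
      have hlt : a < j := lt_of_le_of_ne (not_lt.1 hh) hne.symm
      have h1 := hg j hj
      have h2 := low_split hn σ j hj
      have h3 : (univ.filter (fun x => x < j ∧ m + q ≤ (σ x : ℕ))).card = m := by
        conv_rhs => rw [← cnt_high hn σ]
        congr 1
        ext x
        simp only [mem_filter, mem_univ, true_and, and_iff_right_iff_imp]
        intro hx
        by_contra hh
        have h1 : (σ x : ℕ) < σ a := h.high a x (lt_of_lt_of_le hlt (not_lt.1 hh)) (by omega) hx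
        omega
      omega
    let M := univ.filter (fun x : Fin n => m ≤ (σ x : ℕ) ∧ (σ x : ℕ) < m + q)
    let I := insert a (insert c M)
    have hI : I.card = q + 2 := by
      have hcM : c ∉ M := by simp [M]; omega
      have haM : a ∉ insert c M := by
        simp only [mem_insert, M, mem_filter, mem_univ, true_and, not_or]
        refine ⟨?_, by omega⟩
        rintro rfl; omega
      rw [Finset.card_insert_of_notMem haM, Finset.card_insert_of_notMem hcM, cnt_mid hn σ]
    have hIv : ∀ x ∈ I, x = a ∨ x = c ∨ (m ≤ (σ x : ℕ) ∧ (σ x : ℕ) < m + q) := by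
      intro x hx
      simpa [I, M] using hx
    have hIm : StrictMonoOn σ I := by
      intro x hx y hy hxy
      have hca := hcl a (by omega)
      show (σ x : ℕ) < σ y
      rcases hIv x hx with rfl | rfl | hx' <;> rcases hIv y hy with rfl | rfl | hy'
      · exact absurd hxy (lt_irrefl _)
      · exact absurd hxy hca.not_gt
      · exact absurd hxy (hal y hy'.1 hy'.2).not_gt
      · omega
      · exact absurd hxy (lt_irrefl _)
      · omega
      · omega
      · exact absurd hxy (hcl x hx'.1).not_gt
      · exact h.mid x y hxy hx'.1 hx'.2 hy'.1 hy'.2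
    refine ⟨I, univ.filter (fun x : Fin n => m + q ≤ (σ x : ℕ)), I,
      univ.filter (fun x : Fin n => (σ x : ℕ) < m), hI, hIm, cnt_high hn σ, ?_, hI, hIm,
      cnt_low hn σ, ?_, ?_, ?_⟩
    · intro x hx y hy hxy
      simp at hx hy
      exact h.high x y hxy hx hy
    · intro x hx y hy hxy
      simp at hx hy
      exact h.low x y hxy hx hy
    · intro x hx y hy
      simp at hy
      show (σ x : ℕ) ≤ σ y
      rcases hIv x hx with rfl | rfl | hx <;> omega
    · intro y hy x hx
      simp at hy
      show (σ y : ℕ) ≤ σ x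
      rcases hIv x hx with rfl | rfl | hx <;> omega

theorem mono_anti_inter {n : ℕ} (σ : Fin n → Fin n) (I D : Finset (Fin n))
    (hI : StrictMonoOn σ I) (hD : StrictAntiOn σ D) : (I ∩ D).card ≤ 1 := by
  rw [Finset.card_le_one]
  intro x hx y hy
  rw [mem_inter] at hx hy
  rcases lt_trichotomy x y with h1 | h1 | h1
  · exact absurd (hD hx.2 hy.2 h1) (hI hx.1 hy.1 h1).not_gt
  · exact h1
  · exact absurd (hD hy.2 hx.2 h1) (hI hy.1 hx.1 h1).not_gt

theorem card_three {n : ℕ} (σ : Fin n → Fin n) (I D D' : Finset (Fin n))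
    (hI : StrictMonoOn σ I) (hD : StrictAntiOn σ D) (hD' : StrictAntiOn σ D') :
    I.card ≤ (I ∩ (D ∪ D')ᶜ).card + 2 := by
  have h1 := mono_anti_inter σ I D hI hD
  have h2 := mono_anti_inter σ I D' hI hD'
  have hsub : I ⊆ (I ∩ (D ∪ D')ᶜ) ∪ ((I ∩ D) ∪ (I ∩ D')) := by
    intro x hx
    simp only [mem_union, mem_inter, mem_compl, hx]
    tauto
  have := Finset.card_le_card hsub
  have := Finset.card_union_le (I ∩ (D ∪ D')ᶜ) ((I ∩ D) ∪ (I ∩ D'))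
  have := Finset.card_union_le (I ∩ D) (I ∩ D')
  omega

theorem compl_subset_of {m q n : ℕ} (hn : n = 2 * m + q) (σ : Fin n → Fin n)
    (I D D' : Finset (Fin n))
    (hI : StrictMonoOn σ I) (hD : StrictAntiOn σ D) (hD' : StrictAntiOn σ D')
    (cI : I.card = q + 2) (cE : (D ∪ D')ᶜ.card = q) : (D ∪ D')ᶜ ⊆ I := by
  have := card_three σ I D D' hI hD hD'
  have h2 : I ∩ (D ∪ D')ᶜ = (D ∪ D')ᶜ :=
    Finset.eq_of_subset_of_card_le Finset.inter_subset_right (by omega)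
  rw [← h2]
  exact Finset.inter_subset_left

theorem lemmaB {m q n : ℕ} (hn : n = 2 * m + q) (hq : 1 ≤ q) (σ : Equiv.Perm (Fin n))
    (hdec : ∀ s : Finset (Fin n), StrictAntiOn σ s → s.card ≤ m)
    (I₁ D₁ I₂ D₂ : Finset (Fin n)) (c1 : I₁.card = q + 2) (m1 : StrictMonoOn σ I₁)
    (c2 : D₁.card = m) (m2 : StrictAntiOn σ D₁) (c3 : I₂.card = q + 2) (m3 : StrictMonoOn σ I₂)
    (c4 : D₂.card = m) (m4 : StrictAntiOn σ D₂)
    (h1 : ∀ x ∈ I₁, ∀ y ∈ D₁, σ x ≤ σ y) (h2 : ∀ y ∈ D₂, ∀ x ∈ I₂, σ y ≤ σ x)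
    (hdis : Disjoint D₁ D₂) : Fam m q n σ := by
  classical
  have cE : (D₁ ∪ D₂)ᶜ.card = q := by
    rw [Finset.card_compl, Finset.card_union_of_disjoint hdis, Fintype.card_fin]; omega
  have s1 := compl_subset_of hn σ I₁ D₁ D₂ m1 m2 m4 c1 cE
  have s2 := compl_subset_of hn σ I₂ D₁ D₂ m3 m2 m4 c3 cE
  have hE1 : ∀ e, e ∉ D₁ → e ∉ D₂ → ∀ y ∈ D₁, σ e < σ y := by
    intro e he he' y hy
    refine lt_of_le_of_ne (h1 e (s1 (by simp [he, he'])) y hy) ?_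
    intro hh; rw [σ.injective hh] at he; exact he hy
  have hE2 : ∀ e, e ∉ D₁ → e ∉ D₂ → ∀ y ∈ D₂, σ y < σ e := by
    intro e he he' y hy
    refine lt_of_le_of_ne (h2 y hy e (s2 (by simp [he, he']))) ?_
    intro hh; rw [← σ.injective hh] at he'; exact he' hy
  obtain ⟨e0, he0⟩ : (D₁ ∪ D₂)ᶜ.Nonempty := Finset.card_pos.1 (by omega)
  simp only [mem_compl, mem_union, not_or] at he0
  have h12 : ∀ y ∈ D₂, ∀ z ∈ D₁, σ y < σ z := fun y hy z hz =>
    (hE2 e0 he0.1 he0.2 y hy).trans (hE1 e0 he0.1 he0.2 z hz)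
  have hD2 : ∀ x, x ∉ D₂ → ∀ y ∈ D₂, σ y < σ x := by
    intro x hx y hy
    by_cases hx1 : x ∈ D₁
    · exact h12 y hy x hx1
    · exact hE2 x hx1 hx y hy
  have hD1 : ∀ x, x ∉ D₁ → ∀ y ∈ D₁, σ x < σ y := by
    intro x hx y hy
    by_cases hx1 : x ∈ D₂
    · exact h12 x hx1 y hy
    · exact hE1 x hx hx1 y hy
  have low_iff : ∀ x, (σ x : ℕ) < m ↔ x ∈ D₂ := by
    intro x
    constructor
    · intro hx
      by_contra hc
      have := card_range_perm σ 0 (σ x) (by omega)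
      have hsub : D₂ ⊆ univ.filter (fun z : Fin n => 0 ≤ (σ z : ℕ) ∧ (σ z : ℕ) < σ x) := by
        intro y hy
        simpa using hD2 x hc y hy
      have := Finset.card_le_card hsub
      omega
    · intro hx
      have := card_range_perm σ 0 (σ x + 1) (by omega)
      have hsub : univ.filter (fun z : Fin n => 0 ≤ (σ z : ℕ) ∧ (σ z : ℕ) < σ x + 1) ⊆ D₂ := by
        intro y hy
        simp only [mem_filter, mem_univ, true_and] at hy
        by_contra hc
        have : (σ x : ℕ) < σ y := hD2 y hc x hx
        omega
      have := Finset.card_le_card hsub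
      omega
  have high_iff : ∀ x, m + q ≤ (σ x : ℕ) ↔ x ∈ D₁ := by
    intro x
    constructor
    · intro hx
      by_contra hc
      have := card_range_perm σ (σ x + 1) n le_rfl
      have hsub : D₁ ⊆ univ.filter (fun z : Fin n => σ x + 1 ≤ (σ z : ℕ) ∧ (σ z : ℕ) < n) := by
        intro y hy
        have : (σ x : ℕ) < σ y := hD1 x hc y hy
        simp; omega
      have := Finset.card_le_card hsub
      omega
    · intro hx
      have := card_range_perm σ (σ x) n le_rfl
      have hsub : univ.filter (fun z : Fin n => σ x ≤ (σ z : ℕ) ∧ (σ z : ℕ) < n) ⊆ D₁ := by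
        intro y hy
        simp only [mem_filter, mem_univ, true_and] at hy
        by_contra hc
        have : (σ y : ℕ) < σ x := hD1 y hc x hx
        omega
      have := Finset.card_le_card hsub
      omega
  refine ⟨?_, ?_, ?_, ?_⟩
  · intro x y hxy hx hy
    exact m4 ((low_iff x).1 hx) ((low_iff y).1 hy) hxy
  · intro x y hxy hx hx' hy hy'
    have a1 : x ∈ I₁ := s1 (by simp [← low_iff, ← high_iff]; omega)
    have a2 : y ∈ I₁ := s1 (by simp [← low_iff, ← high_iff]; omega)
    exact m1 a1 a2 hxy
  · intro x y hxy hx hy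
    exact m2 ((high_iff x).1 hx) ((high_iff y).1 hy) hxy
  · rw [GoodW_ltr]
    intro j hj
    by_contra hc
    have hsp := low_split hn σ j hj
    let A := univ.filter (fun x => x < j ∧ m + q ≤ (σ x : ℕ))
    let B := univ.filter (fun x => j < x ∧ (σ x : ℕ) < m)
    have hAv : ∀ x ∈ A, x < j ∧ m + q ≤ (σ x : ℕ) := fun x hx => by simpa [A] using hx
    have hBv : ∀ x ∈ B, j < x ∧ (σ x : ℕ) < m := fun x hx => by simpa [B] using hx
    have hjn : j ∉ A ∪ B := by
      simp [A, B]
    have hAB : Disjoint A B := by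
      rw [Finset.disjoint_left]
      intro x hx hx'
      exact absurd ((hAv x hx).1.trans (hBv x hx').1) (lt_irrefl _)
    have hcard : (insert j (A ∪ B)).card = A.card + B.card + 1 := by
      rw [Finset.card_insert_of_notMem hjn, Finset.card_union_of_disjoint hAB]
    have hanti : StrictAntiOn σ (insert j (A ∪ B) : Finset (Fin n)) := by
      have hAj : ∀ x ∈ A, (σ j : ℕ) < σ x := by
        intro x hx
        have := hAv x hx
        by_cases hj2 : m + q ≤ (σ j : ℕ)
        · exact m2 ((high_iff x).1 this.2) ((high_iff j).1 hj2) this.1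
        · omega
      intro x hx y hy hxy
      rw [mem_coe, mem_insert, mem_union] at hx hy
      show (σ y : ℕ) < σ x
      rcases hx with rfl | hx | hx <;> rcases hy with rfl | hy | hy
      · exact absurd hxy (lt_irrefl _)
      · exact absurd hxy (hAv y hy).1.not_gt
      · have := hBv y hy; omega
      · exact hAj x hx
      · exact m2 ((high_iff x).1 (hAv x hx).2) ((high_iff y).1 (hAv y hy).2) hxy
      · have := hBv y hy; have := hAv x hx; omega
      · exact absurd hxy (hBv x hx).1.not_gt
      · exact absurd hxy ((hAv y hy).1.trans (hBv x hx).1).not_gt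
      · exact m4 ((low_iff x).1 (hBv x hx).2) ((low_iff y).1 (hBv y hy).2) hxy
    have := hdec _ hanti
    change ¬ (A.card < _) at hc
    change _ + B.card = m at hsp
    omega

theorem disj_or {n K : ℕ} (hK : 2 ≤ K) (σ : Equiv.Perm (Fin n))
    (hinc : ∀ s : Finset (Fin n), StrictMonoOn σ s → s.card ≤ K)
    (I₁ D₁ I₂ D₂ : Finset (Fin n)) (c1 : I₁.card = K) (m1 : StrictMonoOn σ I₁)
    (c3 : I₂.card = K) (m3 : StrictMonoOn σ I₂)
    (h1 : ∀ x ∈ I₁, ∀ y ∈ D₁, σ x ≤ σ y) (h2 : ∀ y ∈ D₂, ∀ x ∈ I₂, σ y ≤ σ x) :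
    Disjoint D₁ D₂ ∨ Disjoint I₁ I₂ := by
  classical
  by_contra hc
  rw [not_or, Finset.not_disjoint_iff, Finset.not_disjoint_iff] at hc
  obtain ⟨⟨y, hy1, hy2⟩, ⟨x, hx1, hx2⟩⟩ := hc
  have hxy : x = y := σ.injective (le_antisymm (h1 x hx1 y hy1) (h2 y hy2 x hx2))
  subst hxy
  have t1 : ∀ z ∈ I₁, z ≤ x := fun z hz => (m1.le_iff_le hz hx1).1 (h1 z hz x hy1)
  have t2 : ∀ z ∈ I₂, x ≤ z := fun z hz => (m3.le_iff_le hx2 hz).1 (h2 x hy2 z hz)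
  have hm : StrictMonoOn σ (I₁ ∪ I₂ : Finset (Fin n)) := by
    intro a ha b hb hab
    rw [mem_coe, mem_union] at ha hb
    rcases ha with ha | ha <;> rcases hb with hb | hb
    · exact m1 ha hb hab
    · rcases lt_or_eq_of_le (t1 a ha) with h | h
      · exact lt_of_lt_of_le (m1 ha hx1 h) (m3.monotoneOn hx2 hb (t2 b hb))
      · subst h; exact m3 hx2 hb hab
    · exact absurd hab ((t1 b hb).trans (t2 a ha)).not_gt
    · exact m3 ha hb hab
  have hi : (I₁ ∩ I₂).card ≤ 1 := by
    rw [Finset.card_le_one]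
    intro a ha b hb
    rw [mem_inter] at ha hb
    exact (le_antisymm (t1 a ha.1) (t2 a ha.2)).trans (le_antisymm (t1 b hb.1) (t2 b hb.2)).symm
  have := Finset.card_union_add_card_inter I₁ I₂
  have := hinc _ hm
  omega

instance instDecGoodW {n : ℕ} (w : Fin n → Fin 3) : Decidable (GoodW w) := by
  unfold GoodW; infer_instance

set_option synthInstance.maxHeartbeats 400000 in
set_option synthInstance.maxSize 4000 in
instance instDecFam {m q n : ℕ} (σ : Fin n → Fin n) : Decidable (Fam m q n σ) :=
  decidable_of_iff ((∀ x y, x < y → (σ x : ℕ) < m → (σ y : ℕ) < m → σ y < σ x) ∧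
    (∀ x y, x < y → m ≤ (σ x : ℕ) → (σ x : ℕ) < m + q → m ≤ (σ y : ℕ) →
    (σ y : ℕ) < m + q → σ x < σ y) ∧
    (∀ x y, x < y → m + q ≤ (σ x : ℕ) → m + q ≤ (σ y : ℕ) → σ y < σ x) ∧
    GoodW (fun x => ltr m q (σ x)))
    ⟨fun ⟨a, b, c, d⟩ => ⟨a, b, c, d⟩, fun ⟨a, b, c, d⟩ => ⟨a, b, c, d⟩⟩

set_option synthInstance.maxHeartbeats 400000 in
set_option synthInstance.maxSize 4000 in
theorem four : ∀ a b c d : Fin 4, a ≠ b → a ≠ c → a ≠ d → b ≠ c → b ≠ d → c ≠ d →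
    (∀ x y z : Fin 4, x < y → y < z →
      ¬ ((![a,b,c,d] : Fin 4 → Fin 4) x < (![a,b,c,d] : Fin 4 → Fin 4) y ∧
        (![a,b,c,d] : Fin 4 → Fin 4) y < (![a,b,c,d] : Fin 4 → Fin 4) z) ∧
      ¬ ((![a,b,c,d] : Fin 4 → Fin 4) y < (![a,b,c,d] : Fin 4 → Fin 4) x ∧
        (![a,b,c,d] : Fin 4 → Fin 4) z < (![a,b,c,d] : Fin 4 → Fin 4) y)) →
    Fam 2 0 4 ![a,b,c,d] ∨ Fam 2 0 4 (fun x => ((![a,b,c,d] : Fin 4 → Fin 4) x).rev) := by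
  decide +kernel

theorem four_perm (σ : Equiv.Perm (Fin 4))
    (hinc : ∀ s : Finset (Fin 4), StrictMonoOn σ s → s.card ≤ 2)
    (hdec : ∀ s : Finset (Fin 4), StrictAntiOn σ s → s.card ≤ 2) :
    Fam 2 0 4 σ ∨ Fam 2 0 4 (fun x => (σ x).rev) := by
  have e : (![σ 0, σ 1, σ 2, σ 3] : Fin 4 → Fin 4) = σ := by
    funext x; fin_cases x <;> rfl
  have := four (σ 0) (σ 1) (σ 2) (σ 3) (by simp) (by simp) (by simp) (by simp) (by simp) (by simp)
  rw [e] at this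
  apply this
  intro x y z hxy hyz
  have hc : ({x, y, z} : Finset (Fin 4)).card = 3 := by
    rw [Finset.card_eq_three]
    exact ⟨x, y, z, hxy.ne, (hxy.trans hyz).ne, hyz.ne, rfl⟩
  constructor
  · rintro ⟨h1, h2⟩
    have := hinc {x, y, z} (by
      intro a ha b hb hab
      simp at ha hb
      rcases ha with rfl | rfl | rfl <;> rcases hb with rfl | rfl | rfl <;> grind)
    omega
  · rintro ⟨h1, h2⟩
    have := hdec {x, y, z} (by
      intro a ha b hb hab
      simp at ha hb
      rcases ha with rfl | rfl | rfl <;> rcases hb with rfl | rfl | rfl <;> grind)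
    omega

theorem bicrucial_compl {K n : ℕ} (hK : 1 ≤ K) (σ : Fin n → Fin n)
    (h : Bicrucial (K+1) (K+1) n (fun x => (σ x).rev)) : Bicrucial (K+1) (K+1) n σ := by
  rw [bicrucial_iff hK hK] at *
  simp only [anti_iff, mono_iff, Fin.rev_le_rev] at h
  obtain ⟨a, b, I₁, D₁, I₂, D₂, c1, c2, c3, c4, e3, e4, e1, e2, c5, e5⟩ := h
  exact ⟨b, a, D₁, I₁, D₂, I₂, c3, c4, c1, c2, e1, e2, e3, e4, fun x hx y hy => c5 y hy x hx,
    fun x hx y hy => e5 y hy x hx⟩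

theorem bicrucial_Fam {m q n : ℕ} (hn : n = 2 * m + q) (hm : 2 ≤ m) (hqm : m ≤ q + 2)
    (σ : Equiv.Perm (Fin n)) (h : Bicrucial (q+2+1) (m+1) n σ) :
    Fam m q n σ ∨ (m = q + 2 ∧ Fam m q n (fun x => (σ x).rev)) := by
  classical
  rw [bicrucial_iff (by omega) (by omega)] at h
  obtain ⟨hi, hd, I₁, D₁, I₂, D₂, c1, c2, c3, c4, e3, e4, e1, e2, c5, e5⟩ := h
  rcases Nat.eq_zero_or_pos q with rfl | hq
  · obtain rfl : m = 2 := by omega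
    subst hn
    rcases four_perm σ hi hd with h | h
    · exact Or.inl h
    · exact Or.inr ⟨rfl, h⟩
  rcases disj_or (by omega) σ hi I₁ D₁ I₂ D₂ c1 c2 e3 e4 c5 e5 with h | h
  · exact Or.inl (lemmaB hn hq σ hd I₁ D₁ I₂ D₂ c1 c2 c3 c4 e3 e4 e1 e2 c5 e5 h)
  · right
    have h1 := card_three (fun x => (σ x).rev) D₁ I₁ I₂ ((anti_iff _ _).2 c4) ((mono_iff _ _).2 c2)
      ((mono_iff _ _).2 e4)
    have h2 : (D₁ ∩ (I₁ ∪ I₂)ᶜ).card ≤ (I₁ ∪ I₂)ᶜ.card := Finset.card_le_card Finset.inter_subset_right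
    rw [Finset.card_compl, Finset.card_union_of_disjoint h, Fintype.card_fin] at h2
    have h3 := Finset.card_le_univ (I₁ ∪ I₂)
    rw [Finset.card_union_of_disjoint h, Fintype.card_fin] at h3
    have hmq : m = q + 2 := by omega
    refine ⟨hmq, ?_⟩
    have hσ : (fun x => (σ x).rev) = (σ.trans Fin.revPerm : Equiv.Perm (Fin n)) := rfl
    subst hmq
    refine lemmaB hn hq (σ.trans Fin.revPerm) (fun s hs => hi s ((mono_iff _ _).1 hs)) D₁ I₁ D₂ I₂
      c3 ((anti_iff _ _).2 c4) c1 ((mono_iff _ _).2 c2) e1 ((anti_iff _ _).2 e2)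
      e3 ((mono_iff _ _).2 e4) ?_ ?_ h
    · intro x hx y hy
      exact Fin.rev_le_rev.2 (c5 y hy x hx)
    · intro x hx y hy
      exact Fin.rev_le_rev.2 (e5 y hy x hx)

theorem Fam_not_both {m q n : ℕ} (hn : n = 2 * m + q) (hm : 1 ≤ m) (σ : Fin n → Fin n)
    (h1 : Fam m q n σ) (h2 : Fam m q n (fun x => (σ x).rev)) : False := by
  have g1 := (GoodW_ltr _).1 h1.good ⟨0, by omega⟩
  have g2 := (GoodW_ltr _).1 h2.good ⟨0, by omega⟩
  simp [Fin.lt_def, Fin.val_rev] at g1 g2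
  omega

theorem main_count {m q n : ℕ} (hn : n = 2 * m + q) (hm : 2 ≤ m) (hqm : m ≤ q + 2) :
    Nat.card {σ : Equiv.Perm (Fin n) // Bicrucial (q+2+1) (m+1) n σ} =
      (1 + if m = q + 2 then 1 else 0) * SW n m m := by
  classical
  rw [← Fam_card hn]
  by_cases hmq : m = q + 2
  · have e2 : Nat.card {σ : Equiv.Perm (Fin n) // Fam m q n (fun x => (σ x).rev)} =
        Nat.card {σ : Equiv.Perm (Fin n) // Fam m q n σ} := by
      refine Nat.card_congr (Equiv.subtypeEquiv (Equiv.mulLeft Fin.revPerm) ?_)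
      intro σ
      exact Iff.rfl
    have e : ∀ σ : Equiv.Perm (Fin n), Bicrucial (q+2+1) (m+1) n σ ↔
        (Fam m q n σ ∨ Fam m q n (fun x => (σ x).rev)) := by
      intro σ
      constructor
      · intro h
        rcases bicrucial_Fam hn hm hqm σ h with h | h
        · exact Or.inl h
        · exact Or.inr h.2
      · rintro (h | h)
        · exact Fam_bicrucial hn (by omega) σ h
        · have := Fam_bicrucial hn (by omega) (σ.trans Fin.revPerm) h
          subst hmq
          exact bicrucial_compl (by omega) σ this
    rw [Nat.card_congr (Equiv.subtypeEquivRight e)]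
    rw [if_pos hmq, add_mul, one_mul]
    conv_rhs => rw [← e2]
    simp only [Nat.card_eq_fintype_card]
    rw [Fintype.card_subtype_or_disjoint]
    · rw [← Nat.card_eq_fintype_card, ← Nat.card_eq_fintype_card, e2]
    · rw [Pi.disjoint_iff]
      intro σ
      rw [Prop.disjoint_iff]
      by_contra hc
      exact Fam_not_both hn (by omega) σ hc.1 hc.2
  · rw [if_neg hmq]
    simp only [add_zero, one_mul]
    refine Nat.card_congr (Equiv.subtypeEquivRight fun σ => ⟨fun h => ?_, Fam_bicrucial hn (by omega) σ⟩)
    rcases bicrucial_Fam hn hm hqm σ h with h | h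
    · exact h
    · exact absurd h.1 hmq

/-- count of minimal bicrucial permutations: for `k ≥ l ≥ 3`, the number `s` of
`(k,l)`-bicrucial permutations of the minimal length `k+2l-5` satisfies
`s·(k+l-3)(k+l-4)(l-1)!(l-2)!(k-3)! = (1+δ_{k,l})·(k+2l-5)!`. -/
theorem count_minimal_bicrucial (k l : ℕ) (hl : 3 ≤ l) (hkl : l ≤ k) :
    Nat.card {σ : Equiv.Perm (Fin (k + 2 * l - 5)) // Bicrucial k l (k + 2 * l - 5) ⇑σ} *
        ((k + l - 3) * (k + l - 4) * Nat.factorial (l - 1) * Nat.factorial (l - 2) *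
          Nat.factorial (k - 3)) =
      (1 + if k = l then 1 else 0) * Nat.factorial (k + 2 * l - 5) := by
  obtain ⟨m, rfl⟩ : ∃ m, l = m + 1 := ⟨l - 1, by omega⟩
  obtain ⟨q, rfl⟩ : ∃ q, k = q + 2 + 1 := ⟨k - 3, by omega⟩
  have hn : q + 2 + 1 + 2 * (m + 1) - 5 = 2 * m + q := by omega
  rw [hn, main_count rfl (by omega) (by omega), ← SW_final m q (by omega)]
  have a1 : q + 2 + 1 + (m + 1) - 3 = m + q + 1 := by omega
  have a2 : q + 2 + 1 + (m + 1) - 4 = m + q := by omega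
  have a3 : m + 1 - 1 = m := by omega
  have a4 : m + 1 - 2 = m - 1 := by omega
  have a5 : q + 2 + 1 - 3 = q := by omega
  have a6 : (q + 2 + 1 = m + 1) ↔ (m = q + 2) := by omega
  rw [a1, a2, a3, a4, a5]
  simp only [a6]
  ring
end

section
/- Let k ≥ 3. The number of (k,3)-bicrucial permutations of length k+1 (the minimal possible length of a (k,3)-bicrucial permutation) equals (1+δ_{k,3})(k+1)(k−2)/2, where δ_{k,3} = 1 if k = 3 and δ_{k,3} = 0 otherwise. -/
def rcf {n : ℕ} (σ : Fin n → Fin n) : Fin n → Fin n := fun x => (σ x.rev).rev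

theorem rcf_rcf {n : ℕ} (σ : Fin n → Fin n) : rcf (rcf σ) = σ := by
  funext x; simp [rcf]

theorem hasIncr_rcf' {k n : ℕ} {σ : Fin n → Fin n} (h : HasIncr k n σ) : HasIncr k n (rcf σ) := by
  obtain ⟨f, hf, hg⟩ := h
  refine ⟨fun j => (f j.rev).rev, ?_, ?_⟩
  · intro a b hab
    exact Fin.rev_lt_rev.2 (hf (Fin.rev_lt_rev.2 hab))
  · intro a b hab
    have := hg (Fin.rev_lt_rev.2 hab)
    simpa [rcf] using this

theorem hasIncr_rcf {k n : ℕ} {σ : Fin n → Fin n} : HasIncr k n (rcf σ) ↔ HasIncr k n σ :=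
  ⟨fun h => by simpa [rcf_rcf] using hasIncr_rcf' h, hasIncr_rcf'⟩

theorem hasDecr_rcf' {k n : ℕ} {σ : Fin n → Fin n} (h : HasDecr k n σ) : HasDecr k n (rcf σ) := by
  obtain ⟨f, hf, hg⟩ := h
  refine ⟨fun j => (f j.rev).rev, ?_, ?_⟩
  · intro a b hab
    exact Fin.rev_lt_rev.2 (hf (Fin.rev_lt_rev.2 hab))
  · intro a b hab
    have := hg (Fin.rev_lt_rev.2 hab)
    simpa [rcf] using this

theorem hasDecr_rcf {k n : ℕ} {σ : Fin n → Fin n} : HasDecr k n (rcf σ) ↔ HasDecr k n σ :=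
  ⟨fun h => by simpa [rcf_rcf] using hasDecr_rcf' h, hasDecr_rcf'⟩

theorem leftExt_eq {n : ℕ} (σ : Fin n → Fin n) (i : Fin (n + 1)) :
    leftExt σ i = rcf (rightExt (rcf σ) i.rev) := by
  funext x
  refine Fin.cases ?_ (fun j => ?_) x
  · simp [leftExt, rightExt, rcf]
  · simp [leftExt, rightExt, rcf, Fin.rev_succ, Fin.rev_succAbove]

theorem leftCrucial_iff {k l n : ℕ} (σ : Fin n → Fin n) :
    LeftCrucial k l n σ ↔ RightCrucial k l n (rcf σ) := by
  unfold LeftCrucial RightCrucial AvoidsPat ContainsPat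
  simp only [leftExt_eq, hasIncr_rcf, hasDecr_rcf]
  refine and_congr Iff.rfl ⟨fun h i => ?_, fun h i => h _⟩
  simpa using h i.rev

theorem hasDecr3 {n : ℕ} (σ : Fin n → Fin n) :
    HasDecr 3 n σ ↔ ∃ x y z, x < y ∧ y < z ∧ σ y < σ x ∧ σ z < σ y := by
  constructor
  · rintro ⟨f, hf, hg⟩
    exact ⟨f 0, f 1, f 2, hf (by decide), hf (by decide), hg (by decide), hg (by decide)⟩
  · rintro ⟨x, y, z, h1, h2, h3, h4⟩
    refine ⟨![x, y, z], ?_, ?_⟩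
    · rw [Fin.strictMono_iff_lt_succ]
      intro i; fin_cases i <;> simpa
    · rw [Fin.strictAnti_iff_succ_lt]
      intro i; fin_cases i <;> simpa

theorem hasIncr3 {n : ℕ} (σ : Fin n → Fin n) :
    HasIncr 3 n σ ↔ ∃ x y z, x < y ∧ y < z ∧ σ x < σ y ∧ σ y < σ z := by
  constructor
  · rintro ⟨f, hf, hg⟩
    exact ⟨f 0, f 1, f 2, hf (by decide), hf (by decide), hg (by decide), hg (by decide)⟩
  · rintro ⟨x, y, z, h1, h2, h3, h4⟩
    refine ⟨![x, y, z], ?_, ?_⟩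
    · rw [Fin.strictMono_iff_lt_succ]
      intro i; fin_cases i <;> simpa
    · rw [Fin.strictMono_iff_lt_succ]
      intro i; fin_cases i <;> simpa

def Cond3 {n : ℕ} (σ : Fin n → Fin n) : Prop := 
  (∃ x y, x < y ∧ σ x < σ y ∧ ∃ z, y < z ∧ σ y < σ z) ∨
  (∃ x y, x < y ∧ σ y < σ x ∧ ∃ z, y < z ∧ σ z < σ y)

theorem cond3_iff {n : ℕ} (σ : Fin n → Fin n) : ContainsPat 3 3 n σ ↔ Cond3 σ := by
  unfold ContainsPat Cond3
  rw [hasIncr3, hasDecr3]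
  refine or_congr ?_ ?_
  · constructor
    · rintro ⟨x, y, z, h1, h2, h3, h4⟩; exact ⟨x, y, h1, h3, z, h2, h4⟩
    · rintro ⟨x, y, h1, h3, z, h2, h4⟩; exact ⟨x, y, z, h1, h2, h3, h4⟩
  · constructor
    · rintro ⟨x, y, z, h1, h2, h3, h4⟩; exact ⟨x, y, h1, h3, z, h2, h4⟩
    · rintro ⟨x, y, h1, h3, z, h2, h4⟩; exact ⟨x, y, z, h1, h2, h3, h4⟩

instance {n : ℕ} (σ : Fin n → Fin n) : Decidable (Cond3 σ) := by
  unfold Cond3; infer_instance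

def BC3 (σ : Equiv.Perm (Fin 4)) : Prop :=
  ¬ Cond3 σ ∧ ∀ i : Fin 5, Cond3 (rightExt σ i) ∧ Cond3 (leftExt σ i)

instance (σ : Equiv.Perm (Fin 4)) : Decidable (BC3 σ) := by
  unfold BC3; infer_instance

theorem bc3_iff (σ : Equiv.Perm (Fin 4)) : Bicrucial 3 3 4 σ ↔ BC3 σ := by
  unfold Bicrucial RightCrucial LeftCrucial BC3
  have h : AvoidsPat 3 3 4 σ ↔ ¬ Cond3 σ := by
    rw [← cond3_iff]; unfold AvoidsPat ContainsPat; tauto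
  simp only [cond3_iff, h]
  exact ⟨fun h => ⟨h.1.1, fun i => ⟨h.1.2 i, h.2.2 i⟩⟩,
    fun h => ⟨⟨h.1, fun i => (h.2 i).1⟩, ⟨h.1, fun i => (h.2 i).2⟩⟩⟩

theorem card3 : Nat.card {σ : Equiv.Perm (Fin (3 + 1)) // Bicrucial 3 3 (3 + 1) ⇑σ} = 4 := by
  have : Nat.card {σ : Equiv.Perm (Fin (3 + 1)) // Bicrucial 3 3 (3 + 1) ⇑σ} =
      Nat.card {σ : Equiv.Perm (Fin 4) // BC3 σ} :=
    Nat.card_congr (Equiv.subtypeEquivRight bc3_iff)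
  rw [this, Nat.card_eq_fintype_card]
  decide +kernel

theorem rightExt_castSucc {n : ℕ} (σ : Fin n → Fin n) (i : Fin (n + 1)) (x : Fin n) :
    rightExt σ i x.castSucc = i.succAbove (σ x) := by
  simp [rightExt]

theorem rightExt_last {n : ℕ} (σ : Fin n → Fin n) (i : Fin (n + 1)) :
    rightExt σ i (Fin.last n) = i := by
  simp [rightExt]

theorem right_nec {m n : ℕ} (σ : Fin n → Fin n) (i : Fin (n + 1))
    (hav : AvoidsPat (m + 1) 3 n σ) (h : ContainsPat (m + 1) 3 (n + 1) (rightExt σ i)) :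
    (∃ f : Fin m → Fin n, StrictMono f ∧ StrictMono (σ ∘ f) ∧ ∀ j, (σ (f j)).castSucc < i) ∨
    ∃ x y, x < y ∧ σ y < σ x ∧ i ≤ (σ y).castSucc := by
  rcases h with ⟨f, hf, hg⟩ | h
  · left
    have hlt : ∀ j : Fin m, f j.castSucc < Fin.last n := fun j =>
      lt_of_lt_of_le (hf (Fin.castSucc_lt_last j)) (Fin.le_last _)
    by_cases hl : f (Fin.last m) = Fin.last n
    · have : ∀ j : Fin m, ∃ x : Fin n, f j.castSucc = x.castSucc := fun j =>
        ⟨(f j.castSucc).castPred (hlt j).ne, by simp⟩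
      choose g hgf using this
      refine ⟨g, ?_, ?_, ?_⟩
      · intro a b hab
        have := hf (Fin.castSucc_lt_castSucc_iff.2 hab)
        rwa [hgf, hgf, Fin.castSucc_lt_castSucc_iff] at this
      · intro a b hab
        have := hg (Fin.castSucc_lt_castSucc_iff.2 hab)
        simpa [hgf, rightExt_castSucc] using this
      · intro j
        have := hg (Fin.castSucc_lt_last j)
        simp only [Function.comp, hgf, hl, rightExt_castSucc, rightExt_last] at this
        exact Fin.succAbove_lt_iff_castSucc_lt _ _ |>.1 this
    · exfalso
      apply hav.1
      have : ∀ j : Fin (m + 1), ∃ x : Fin n, f j = x.castSucc := fun j =>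
        ⟨(f j).castPred (fun h => hl (le_antisymm (Fin.le_last _)
          (h ▸ hf.monotone (Fin.le_last j)))), by simp⟩
      choose g hgf using this
      refine ⟨g, ?_, ?_⟩
      · intro a b hab
        have := hf hab
        rwa [hgf, hgf, Fin.castSucc_lt_castSucc_iff] at this
      · intro a b hab
        have := hg hab
        simpa [hgf, rightExt_castSucc] using this
  · right
    rw [hasDecr3] at h
    obtain ⟨x, y, z, h1, h2, h3, h4⟩ := h
    have hx : x ≠ Fin.last n := ((h1.trans h2).trans_le (Fin.le_last _)).ne
    have hy : y ≠ Fin.last n := (h2.trans_le (Fin.le_last _)).ne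
    obtain ⟨x, rfl⟩ : ∃ x' : Fin n, x = x'.castSucc := ⟨x.castPred hx, by simp⟩
    obtain ⟨y, rfl⟩ : ∃ x' : Fin n, y = x'.castSucc := ⟨y.castPred hy, by simp⟩
    by_cases hz : z = Fin.last n
    · subst hz
      refine ⟨x, y, by simpa using h1, by simpa [rightExt_castSucc] using h3, ?_⟩
      rw [rightExt_castSucc, rightExt_last] at h4
      exact Fin.lt_succAbove_iff_le_castSucc _ _ |>.1 h4
    · obtain ⟨z, rfl⟩ : ∃ x' : Fin n, z = x'.castSucc := ⟨z.castPred hz, by simp⟩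
      exfalso
      apply hav.2
      rw [hasDecr3]
      exact ⟨x, y, z, by simpa using h1, by simpa using h2,
        by simpa [rightExt_castSucc] using h3, by simpa [rightExt_castSucc] using h4⟩

theorem right_suf_incr {m n : ℕ} (σ : Fin n → Fin n) (i : Fin (n + 1))
    (f : Fin m → Fin n) (hf : StrictMono f) (hg : StrictMono (σ ∘ f))
    (hi : ∀ j, (σ (f j)).castSucc < i) : HasIncr (m + 1) (n + 1) (rightExt σ i) := by
  refine ⟨Fin.snoc (α := fun _ => Fin (n + 1)) (fun j => (f j).castSucc) (Fin.last n), ?_, ?_⟩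
  · intro a b hab
    induction b using Fin.lastCases with
    | last =>
      induction a using Fin.lastCases with
      | last => exact absurd hab (lt_irrefl _)
      | cast a => simp [Fin.castSucc_lt_last]
    | cast b =>
      induction a using Fin.lastCases with
      | last => exact absurd hab (not_lt.2 (Fin.le_last _))
      | cast a => simpa using hf (by simpa using hab)
  · intro a b hab
    induction b using Fin.lastCases with
    | last =>
      induction a using Fin.lastCases with
      | last => exact absurd hab (lt_irrefl _)
      | cast a =>
        simp only [Function.comp, Fin.snoc_castSucc, Fin.snoc_last, rightExt_castSucc,
          rightExt_last]
        exact Fin.succAbove_lt_iff_castSucc_lt _ _ |>.2 (hi a)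
    | cast b =>
      induction a using Fin.lastCases with
      | last => exact absurd hab (not_lt.2 (Fin.le_last _))
      | cast a => simpa [rightExt_castSucc] using hg (show a < b by simpa using hab)

theorem right_suf_decr {n : ℕ} (σ : Fin n → Fin n) (i : Fin (n + 1)) (x y : Fin n)
    (h1 : x < y) (h2 : σ y < σ x) (h3 : i ≤ (σ y).castSucc) :
    HasDecr 3 (n + 1) (rightExt σ i) := by
  rw [hasDecr3]
  refine ⟨x.castSucc, y.castSucc, Fin.last n, by simpa, Fin.castSucc_lt_last _, ?_, ?_⟩
  · simpa [rightExt_castSucc]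
  · rw [rightExt_castSucc, rightExt_last]
    exact Fin.lt_succAbove_iff_le_castSucc _ _ |>.2 h3

def rcP {n : ℕ} (σ : Equiv.Perm (Fin n)) : Equiv.Perm (Fin n) where
  toFun := rcf σ
  invFun := rcf σ.symm
  left_inv x := by simp [rcf]
  right_inv x := by simp [rcf]

theorem nec {m : ℕ} (σ : Equiv.Perm (Fin (m + 2)))
    (h : RightCrucial (m + 1) 3 (m + 2) σ) :
    (∃ g : Fin m → Fin (m + 2), StrictMono g ∧ StrictMono (σ.symm ∘ g) ∧
      ∀ j, (g j).val < m + 1) ∧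
    (σ.symm ⟨m + 1, by omega⟩ < σ.symm ⟨m, by omega⟩ ∨
      ∀ a b : Fin (m + 2), a < b → b.val < m → σ.symm a < σ.symm b) := by
  have key : ∀ i : Fin (m + 3),
      (∃ g : Fin m → Fin (m + 2), StrictMono g ∧ StrictMono (σ.symm ∘ g) ∧
        ∀ j, (g j).val < i.val) ∨
      ∃ a b, a < b ∧ σ.symm b < σ.symm a ∧ i.val ≤ a.val := by
    intro i
    rcases right_nec _ i h.1 (h.2 i) with ⟨f, h1, h2, h3⟩ | ⟨x, y, h1, h2, h3⟩
    · left
      refine ⟨σ ∘ f, h2, ?_, fun j => h3 j⟩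
      intro a b hab
      simpa using h1 hab
    · right
      exact ⟨σ y, σ x, h2, by simpa using h1, h3⟩
  constructor
  · rcases key ⟨m + 1, by omega⟩ with h | ⟨a, b, h1, -, h3⟩
    · exact h
    · have := b.2
      have : a.val < b.val := h1
      simp at h3
      omega
  · rcases key ⟨m, by omega⟩ with ⟨g, h1, h2, h3⟩ | ⟨a, b, h1, h2, h3⟩
    · right
      have hid : ∀ a : Fin (m + 2), a.val < m → ∃ j, g j = a := by
        have hinj : Function.Injective (fun j : Fin m => (⟨(g j).val, h3 j⟩ : Fin m)) := by
          intro x y hxy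
          exact h1.injective (Fin.ext (by simpa using hxy))
        have hsurj := Finite.surjective_of_injective hinj
        intro a ha
        obtain ⟨j, hj⟩ := hsurj ⟨a.val, ha⟩
        exact ⟨j, Fin.ext (by simpa using hj)⟩
      intro a b hab hb
      obtain ⟨x, rfl⟩ := hid a (lt_trans hab hb)
      obtain ⟨y, rfl⟩ := hid b hb
      exact h2 (h1.lt_iff_lt.1 hab)
    · left
      have h1' : a.val < b.val := h1
      have h4 := b.2
      simp at h3
      have ha : a = ⟨m, by omega⟩ := Fin.ext (by simp; omega)
      have hb : b = ⟨m + 1, by omega⟩ := Fin.ext (by simp; omega)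
      rwa [← ha, ← hb]

theorem rv0 (m : ℕ) : Fin.rev (⟨0, by omega⟩ : Fin (m + 2)) = ⟨m + 1, by omega⟩ := by
  apply Fin.ext; simp [Fin.val_rev]
theorem rv1 (m : ℕ) : Fin.rev (⟨1, by omega⟩ : Fin (m + 2)) = ⟨m, by omega⟩ := by
  apply Fin.ext; simp [Fin.val_rev]
theorem rvm (m : ℕ) : Fin.rev (⟨m, by omega⟩ : Fin (m + 2)) = ⟨1, by omega⟩ := by
  apply Fin.ext; simp [Fin.val_rev]
theorem rvl (m : ℕ) : Fin.rev (⟨m + 1, by omega⟩ : Fin (m + 2)) = ⟨0, by omega⟩ := by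
  apply Fin.ext; simp [Fin.val_rev]

structure Good (m : ℕ) (π : Fin (m + 2) → Fin (m + 2)) : Prop where
  mid : ∀ a b : Fin (m + 2), 1 ≤ a.val → a < b → b.val ≤ m → π a < π b
  lo : π ⟨1, by omega⟩ < π ⟨0, by omega⟩
  hi : π ⟨m + 1, by omega⟩ < π ⟨m, by omega⟩
  no : ∀ j, π ⟨m + 1, by omega⟩ < π j → ¬ π j < π ⟨0, by omega⟩

theorem Good.rc {m : ℕ} {π : Fin (m + 2) → Fin (m + 2)} (h : Good m π) : Good m (rcf π) where
  mid a b ha hab hb := by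
    have hab' : a.val < b.val := hab
    unfold rcf
    rw [Fin.rev_lt_rev]
    apply h.mid
    · rw [Fin.val_rev]; omega
    · exact Fin.rev_lt_rev.2 hab
    · rw [Fin.val_rev]; omega
  lo := by
    unfold rcf
    rw [Fin.rev_lt_rev, rv0, rv1]
    exact h.hi
  hi := by
    unfold rcf
    rw [Fin.rev_lt_rev, rvm, rvl]
    exact h.lo
  no j h1 h2 := by
    unfold rcf at h1 h2
    rw [Fin.rev_lt_rev] at h1 h2
    rw [rvl] at h1
    rw [rv0] at h2
    exact h.no j.rev h2 h1

theorem Good.avoids {m : ℕ} (hm : 2 ≤ m) {σ : Equiv.Perm (Fin (m + 2))} (h : Good m σ.symm) :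
    AvoidsPat (m + 1) 3 (m + 2) σ := by
  constructor
  · rintro ⟨f, hf, hg⟩
    set g := σ ∘ f with hgdef
    have hord : ∀ x y, g x < g y → σ.symm (g x) < σ.symm (g y) := by
      intro x y hxy
      simpa [hgdef] using hf (hg.lt_iff_lt.1 hxy)
    -- the image has m+1 elements, so misses just one
    have hmiss : ∀ u v : Fin (m + 2), u ≠ v → (∀ j, g j ≠ u) → (∀ j, g j ≠ v) → False := by
      intro u v huv hu hv
      have hsub : Finset.univ.image g ⊆ (Finset.univ.erase u).erase v := by
        intro w hw
        simp only [Finset.mem_image, Finset.mem_univ, true_and] at hw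
        obtain ⟨j, rfl⟩ := hw
        simp [hu j, hv j]
      have := Finset.card_le_card hsub
      rw [Finset.card_image_of_injective _ hg.injective, Finset.card_erase_of_mem (by simp [huv.symm]),
        Finset.card_erase_of_mem (by simp)] at this
      simp at this
    have h01 : ∃ u : Fin (m + 2), u.val ≤ 1 ∧ ∀ j, g j ≠ u := by
      by_contra hcon
      push Not at hcon
      obtain ⟨x, hx⟩ := hcon ⟨0, by omega⟩ (by simp)
      obtain ⟨y, hy⟩ := hcon ⟨1, by omega⟩ (by simp)
      have := hord x y (by rw [hx, hy]; simp [Fin.lt_def])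
      rw [hx, hy] at this
      exact lt_asymm this h.lo
    have h23 : ∃ u : Fin (m + 2), m ≤ u.val ∧ ∀ j, g j ≠ u := by
      by_contra hcon
      push Not at hcon
      obtain ⟨x, hx⟩ := hcon ⟨m, by omega⟩ (by simp)
      obtain ⟨y, hy⟩ := hcon ⟨m + 1, by omega⟩ (by simp)
      have := hord x y (by rw [hx, hy]; simp [Fin.lt_def])
      rw [hx, hy] at this
      exact lt_asymm this h.hi
    obtain ⟨u, hu, hu'⟩ := h01
    obtain ⟨v, hv, hv'⟩ := h23
    exact hmiss u v (by rintro rfl; omega) hu' hv'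
  · rw [hasDecr3]
    rintro ⟨x, y, z, h1, h2, h3, h4⟩
    obtain ⟨a, rfl⟩ := σ.symm.surjective x
    obtain ⟨b, rfl⟩ := σ.symm.surjective y
    obtain ⟨c, rfl⟩ := σ.symm.surjective z
    simp only [Equiv.apply_symm_apply] at h3 h4
    have h3' : b.val < a.val := h3
    have h4' : c.val < b.val := h4
    have ha := a.2
    by_cases hA : a.val = m + 1
    · by_cases hC : c.val = 0
      · have e1 : a = ⟨m + 1, by omega⟩ := Fin.ext hA
        have e2 : c = ⟨0, by omega⟩ := Fin.ext hC
        rw [e1] at h1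
        rw [e2] at h2
        exact h.no b h1 h2
      · exact lt_asymm h2 (h.mid c b (by omega) h4 (by omega))
    · exact lt_asymm h1 (h.mid b a (by omega) h3 (by omega))

theorem Good.right {m : ℕ} (hm : 2 ≤ m) {σ : Equiv.Perm (Fin (m + 2))} (h : Good m σ.symm) :
    RightCrucial (m + 1) 3 (m + 2) σ := by
  refine ⟨h.avoids hm, fun i => ?_⟩
  by_cases hi : i.val ≤ m
  · right
    refine right_suf_decr _ i _ _ h.hi ?_ ?_
    · simp [Fin.lt_def]
    · simpa [Fin.le_def] using hi
  · left
    refine right_suf_incr _ i (fun j : Fin m => σ.symm ⟨j.val + 1, by omega⟩) ?_ ?_ ?_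
    · intro a b hab
      have hab' : a.val < b.val := hab
      have := b.2
      exact h.mid _ _ (by simp) (Fin.mk_lt_mk.2 (by omega)) (by simp)
    · intro a b hab
      have hab' : a.val < b.val := hab
      simp only [Function.comp, Equiv.apply_symm_apply]
      exact Fin.mk_lt_mk.2 (by omega)
    · intro j
      have := j.2
      simp [Fin.lt_def]
      omega

theorem Good.bicrucial {m : ℕ} (hm : 2 ≤ m) {σ : Equiv.Perm (Fin (m + 2))}
    (h : Good m σ.symm) : Bicrucial (m + 1) 3 (m + 2) σ := by
  refine ⟨h.right hm, ?_⟩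
  rw [leftCrucial_iff]
  exact Good.right (σ := rcP σ) hm h.rc

theorem good_of_bicrucial {m : ℕ} (hm : 3 ≤ m) {σ : Equiv.Perm (Fin (m + 2))}
    (h : Bicrucial (m + 1) 3 (m + 2) σ) : Good m σ.symm := by
  obtain ⟨hr, hl⟩ := h
  have hav := hr.1
  rw [leftCrucial_iff] at hl
  obtain ⟨⟨g, hg1, hg2, hg3⟩, hB⟩ := nec σ hr
  obtain ⟨-, hB'⟩ := nec (rcP σ) hl
  have hB' : σ.symm ⟨1, by omega⟩ < σ.symm ⟨0, by omega⟩ ∨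
      ∀ a b : Fin (m + 2), a < b → 2 ≤ a.val → σ.symm a < σ.symm b := by
    rcases hB' with h | h
    · left
      have h' : (σ.symm (Fin.rev ⟨m + 1, by omega⟩)).rev < (σ.symm (Fin.rev ⟨m, by omega⟩)).rev := h
      rw [Fin.rev_lt_rev, rvm, rvl] at h'
      exact h'
    · right
      intro a b hab ha
      have hab' : a.val < b.val := hab
      have h' : (σ.symm (b.rev.rev)).rev < (σ.symm a.rev.rev).rev :=
        h b.rev a.rev (Fin.rev_lt_rev.2 hab) (by rw [Fin.val_rev]; omega)
      rw [Fin.rev_lt_rev] at h'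
      simpa using h'
  -- inverse relation
  have hnot : ¬ ((∀ a b : Fin (m + 2), a < b → b.val < m → σ.symm a < σ.symm b) ∧
      ∀ a b : Fin (m + 2), a < b → 2 ≤ a.val → σ.symm a < σ.symm b) := by
    rintro ⟨h1, h2⟩
    have h3 : ∀ a b : Fin (m + 2), a < b → σ.symm a < σ.symm b := by
      intro a b hab
      have hab' : a.val < b.val := hab
      by_cases hb : b.val < m
      · exact h1 a b hab hb
      · by_cases ha : 2 ≤ a.val
        · exact h2 a b hab ha
        · exact (h1 a ⟨2, by omega⟩ (by simp [Fin.lt_def]; omega) (by simp; omega)).trans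
            (h2 _ b (by simp [Fin.lt_def]; omega) (by simp))
    apply hav.1
    refine ⟨fun j => σ.symm j.castSucc, ?_, ?_⟩
    · intro a b hab
      exact h3 _ _ (by simpa using hab)
    · intro a b hab
      simpa using hab
  have hhi : σ.symm ⟨m + 1, by omega⟩ < σ.symm ⟨m, by omega⟩ := by
    rcases hB with h | h
    · exact h
    · exfalso
      rcases hB' with h' | h'
      · exact lt_asymm h' (h _ _ (by simp [Fin.lt_def]) (by simp; omega))
      · exact hnot ⟨h, h'⟩
  have hlo : σ.symm ⟨1, by omega⟩ < σ.symm ⟨0, by omega⟩ := by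
    rcases hB' with h | h
    · exact h
    · exact absurd hhi (lt_asymm (h _ _ (by simp [Fin.lt_def]) (by simp; omega)))
  have hmiss : ∀ u v : Fin (m + 2), u ≠ v → u.val ≤ m → v.val ≤ m →
      (∀ j, g j ≠ u) → (∀ j, g j ≠ v) → False := by
    intro u v huv hum hvm hu hv
    have hsub : Finset.univ.image g ⊆ (((Finset.univ.erase (Fin.last (m + 1))).erase u).erase v) := by
      intro w hw
      simp only [Finset.mem_image, Finset.mem_univ, true_and] at hw
      obtain ⟨j, rfl⟩ := hw
      have : g j ≠ Fin.last (m + 1) := fun h => by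
        have := hg3 j; rw [h] at this; simp at this
      simp [hu j, hv j, this]
    have hu1 : u ≠ Fin.last (m + 1) := fun h => by rw [h] at hum; simp at hum
    have hv1 : v ≠ Fin.last (m + 1) := fun h => by rw [h] at hvm; simp at hvm
    have := Finset.card_le_card hsub
    rw [Finset.card_image_of_injective _ hg1.injective,
      Finset.card_erase_of_mem (by simp [huv.symm, hv1]),
      Finset.card_erase_of_mem (by simp [hu1]), Finset.card_erase_of_mem (by simp)] at this
    simp at this
    omega
  have hord : ∀ x y, g x < g y → σ.symm (g x) < σ.symm (g y) := fun x y hxy =>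
    hg2 (hg1.lt_iff_lt.1 hxy)
  obtain ⟨u, hu, hu'⟩ : ∃ u : Fin (m + 2), u.val ≤ 1 ∧ ∀ j, g j ≠ u := by
    by_contra hcon
    push Not at hcon
    obtain ⟨x, hx⟩ := hcon ⟨0, by omega⟩ (by simp)
    obtain ⟨y, hy⟩ := hcon ⟨1, by omega⟩ (by simp)
    have := hord x y (by rw [hx, hy]; simp [Fin.lt_def])
    rw [hx, hy] at this
    exact lt_asymm this hlo
  have hin : ∀ v : Fin (m + 2), v ≠ u → v.val ≤ m → ∃ j, g j = v := by
    intro v hvu hv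
    by_contra hcon
    push Not at hcon
    exact hmiss u v hvu.symm (by omega) hv hu' hcon
  have hord2 : ∀ a b : Fin (m + 2), a ≠ u → b ≠ u → a < b → b.val ≤ m → σ.symm a < σ.symm b := by
    intro a b ha hb hab hbm
    have hab' : a.val < b.val := hab
    obtain ⟨x, rfl⟩ := hin a ha (by omega)
    obtain ⟨y, rfl⟩ := hin b hb hbm
    exact hord _ _ hab
  have hmid : ∀ a b : Fin (m + 2), 1 ≤ a.val → a < b → b.val ≤ m → σ.symm a < σ.symm b := by
    intro a b ha hab hbm
    have hab' : a.val < b.val := hab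
    have hbu : b ≠ u := by rintro rfl; omega
    by_cases hau : a = u
    · subst hau
      have ea : a = ⟨1, by omega⟩ := Fin.ext (by simp; omega)
      have := hord2 ⟨0, by omega⟩ b (by rw [ea]; simp) hbu (Fin.lt_def.2 (by simp only []; omega)) hbm
      exact (ea ▸ hlo).trans this
    · exact hord2 a b hau hbu hab hbm
  refine ⟨hmid, hlo, hhi, fun j h1 h2 => ?_⟩
  apply hav.2
  rw [hasDecr3]
  refine ⟨_, _, _, h1, h2, ?_, ?_⟩
  · simp only [Equiv.apply_symm_apply]
    by_contra hcon
    have e : j = ⟨m + 1, by omega⟩ := Fin.ext (by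
      have := j.2
      rw [Fin.lt_def] at hcon; simp only [] at hcon ⊢; omega)
    rw [e] at h1; exact lt_irrefl _ h1
  · simp only [Equiv.apply_symm_apply]
    by_contra hcon
    have e : j = ⟨0, by omega⟩ := Fin.ext (by
      rw [Fin.lt_def] at hcon; simp only [] at hcon ⊢; omega)
    rw [e] at h2; exact lt_irrefl _ h2

theorem bicrucial_iff_s12 {m : ℕ} (hm : 3 ≤ m) (σ : Equiv.Perm (Fin (m + 2))) :
    Bicrucial (m + 1) 3 (m + 2) σ ↔ Good m σ.symm :=
  ⟨good_of_bicrucial hm, Good.bicrucial (by omega)⟩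

def FF {m : ℕ} (p : Fin (m + 2)) (q : Fin (m + 1)) : Fin (m + 2) → Fin (m + 2) :=
  Fin.cons p (fun j => p.succAbove
    (Fin.snoc (α := fun _ => Fin (m + 1)) (fun i : Fin m => q.succAbove i) q j))

theorem FF_zero {m : ℕ} (p : Fin (m + 2)) (q : Fin (m + 1)) : FF p q ⟨0, by omega⟩ = p := rfl

theorem FF_last {m : ℕ} (p : Fin (m + 2)) (q : Fin (m + 1)) :
    FF p q ⟨m + 1, by omega⟩ = p.succAbove q := by
  have : (⟨m + 1, by omega⟩ : Fin (m + 2)) = (Fin.last m).succ := rfl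
  rw [this, FF, Fin.cons_succ, Fin.snoc_last]

theorem FF_mid {m : ℕ} (p : Fin (m + 2)) (q : Fin (m + 1)) (i : Fin m) :
    FF p q ⟨i.val + 1, by omega⟩ = p.succAbove (q.succAbove i) := by
  have : (⟨i.val + 1, by omega⟩ : Fin (m + 2)) = i.castSucc.succ := rfl
  rw [this, FF, Fin.cons_succ, Fin.snoc_castSucc]

theorem fin_cases3 {m : ℕ} (x : Fin (m + 2)) :
    x = ⟨0, by omega⟩ ∨ x = ⟨m + 1, by omega⟩ ∨ ∃ i : Fin m, x = ⟨i.val + 1, by omega⟩ := by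
  by_cases h0 : x.val = 0
  · left; exact Fin.ext h0
  · by_cases h1 : x.val = m + 1
    · right; left; exact Fin.ext h1
    · right; right
      have := x.2
      exact ⟨⟨x.val - 1, by omega⟩, Fin.ext (by simp only []; omega)⟩

theorem FF_inj {m : ℕ} (p : Fin (m + 2)) (q : Fin (m + 1)) : Function.Injective (FF p q) := by
  have hS : Function.Injective (Fin.snoc (α := fun _ => Fin (m + 1))
      (fun i : Fin m => q.succAbove i) q) := by
    intro a b
    induction b using Fin.lastCases with
    | last =>
      induction a using Fin.lastCases with
      | last => simp
      | cast a => simp [Fin.succAbove_ne]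
    | cast b =>
      induction a using Fin.lastCases with
      | last => simp [Fin.ne_succAbove]
      | cast a => simp
  unfold FF
  rw [Fin.cons_injective_iff]
  refine ⟨?_, fun a b hab => hS (Fin.succAbove_right_injective hab)⟩
  rintro ⟨j, hj⟩
  exact Fin.succAbove_ne _ _ hj

noncomputable def FP {m : ℕ} (p : Fin (m + 2)) (q : Fin (m + 1)) : Equiv.Perm (Fin (m + 2)) :=
  Equiv.ofBijective (FF p q) (Finite.injective_iff_bijective.1 (FF_inj p q))

theorem val_sa {n : ℕ} (p : Fin (n + 1)) (x : Fin n) :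
    (p.succAbove x).val = if x.val < p.val then x.val else x.val + 1 := by
  unfold Fin.succAbove
  simp only [Fin.lt_def, Fin.val_castSucc]
  split <;> simp

theorem good_FF {m : ℕ} (hm : 1 ≤ m) (p : Fin (m + 2)) (q : Fin (m + 1)) :
    Good m (FF p q) ↔ 1 ≤ q.val ∧ q.val < m ∧ 1 ≤ p.val ∧ p.val ≤ q.val + 1 := by
  have e1 : FF p q ⟨1, by omega⟩ = p.succAbove (q.succAbove ⟨0, by omega⟩) :=
    FF_mid p q ⟨0, by omega⟩
  have em : FF p q ⟨m, by omega⟩ = p.succAbove (q.succAbove ⟨m - 1, by omega⟩) := by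
    rw [← FF_mid p q ⟨m - 1, by omega⟩]
    congr 1; apply Fin.ext; simp only []; omega
  have hp := p.2
  have hq := q.2
  constructor
  · rintro ⟨-, hlo, hhi, hno⟩
    rw [e1, FF_zero, Fin.lt_def, val_sa, val_sa] at hlo
    rw [em, FF_last, Fin.lt_def, val_sa, val_sa, val_sa] at hhi
    simp only [] at hlo hhi
    have hno' : ∀ j : Fin m, ¬ (q.val ≤ j.val ∧ j.val + 1 < p.val) := by
      rintro j ⟨h1, h2⟩
      apply hno ⟨j.val + 1, by omega⟩
      · rw [FF_mid, FF_last, Fin.lt_def, val_sa, val_sa, val_sa]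
        split_ifs <;> omega
      · rw [FF_mid, FF_zero, Fin.lt_def, val_sa, val_sa]
        split_ifs <;> omega
    have h3 : p.val ≤ q.val + 1 := by
      by_contra hcon
      exact hno' ⟨q.val, by omega⟩ ⟨le_rfl, by simp only []; omega⟩
    split_ifs at hlo hhi <;> omega
  · rintro ⟨h1, h2, h3, h4⟩
    refine ⟨?_, ?_, ?_, ?_⟩
    · intro a b ha hab hb
      have hab' : a.val < b.val := hab
      rcases fin_cases3 a with rfl | rfl | ⟨i, rfl⟩
      · simp at ha
      · simp only [] at hab'; omega
      rcases fin_cases3 b with rfl | rfl | ⟨j, rfl⟩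
      · simp at hab'
      · simp at hb
      rw [FF_mid, FF_mid]
      apply Fin.strictMono_succAbove
      apply Fin.strictMono_succAbove
      simp only [] at hab'
      exact Fin.lt_def.2 (by omega)
    · rw [e1, FF_zero, Fin.lt_def, val_sa, val_sa]
      simp only []
      split_ifs <;> omega
    · rw [em, FF_last, Fin.lt_def, val_sa, val_sa, val_sa]
      simp only []
      split_ifs <;> omega
    · intro j h5 h6
      rw [FF_last, Fin.lt_def, val_sa] at h5
      rw [FF_zero, Fin.lt_def] at h6
      split_ifs at h5 <;> omega

theorem exists_FF {m : ℕ} (π : Equiv.Perm (Fin (m + 2))) (h : Good m π) :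
    ∃ p q, FP p q = π := by
  have hne : ∀ x : Fin (m + 2), x ≠ ⟨0, by omega⟩ → π x ≠ π ⟨0, by omega⟩ := fun x hx e =>
    hx (π.injective e)
  set p := π ⟨0, by omega⟩ with hp
  obtain ⟨q, hq⟩ := Fin.exists_succAbove_eq (hne ⟨m + 1, by omega⟩ (by simp))
  have h1 : ∀ i : Fin m, ∃ y : Fin m, p.succAbove (q.succAbove y) = π ⟨i.val + 1, by omega⟩ := by
    intro i
    obtain ⟨z, hz⟩ := Fin.exists_succAbove_eq (hne ⟨i.val + 1, by omega⟩ (by simp))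
    have : z ≠ q := by
      rintro rfl
      rw [hq] at hz
      have := π.injective hz
      simp only [Fin.mk.injEq] at this
      omega
    obtain ⟨y, hy⟩ := Fin.exists_succAbove_eq this
    exact ⟨y, by rw [hy, hz]⟩
  choose g hg using h1
  have hmono : StrictMono g := by
    intro a b hab
    have hab' : a.val < b.val := hab
    have := h.mid ⟨a.val + 1, by omega⟩ ⟨b.val + 1, by omega⟩ (by simp)
      (Fin.mk_lt_mk.2 (by omega)) (by simp only []; omega)
    rw [← hg, ← hg] at this
    simpa using this
  have hid : g = id := by
    refine (StrictMono.range_inj hmono strictMono_id).1 ?_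
    rw [Set.range_id]
    exact Set.range_eq_univ.2 (Finite.surjective_of_injective hmono.injective)
  refine ⟨p, q, Equiv.ext fun x => ?_⟩
  change FF p q x = π x
  rcases fin_cases3 x with rfl | rfl | ⟨i, rfl⟩
  · rw [FF_zero]
  · rw [FF_last, hq]
  · rw [FF_mid, ← hg, hid]; rfl

theorem card_good (t : ℕ) :
    2 * Nat.card {π : Equiv.Perm (Fin (t + 1 + 2)) // Good (t + 1) π} = (t + 3) * t := by
  let G : (Σ q : Fin t, Fin (q.val + 2)) → {π : Equiv.Perm (Fin (t + 1 + 2)) // Good (t + 1) π} :=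
    fun x => ⟨FP ⟨x.2.val + 1, by omega⟩ ⟨x.1.val + 1, by omega⟩,
      (good_FF (by omega) _ _).2 ⟨by simp, by simp, by simp, by simp only []; omega⟩⟩
  have hG : Function.Bijective G := by
    constructor
    · rintro ⟨q, p⟩ ⟨q', p'⟩ h
      have h0 := congrArg Subtype.val h
      have h1 : ∀ x, FF (m := t + 1) ⟨p.val + 1, by omega⟩ ⟨q.val + 1, by omega⟩ x =
        FF ⟨p'.val + 1, by omega⟩ ⟨q'.val + 1, by omega⟩ x := fun x => DFunLike.congr_fun h0 x
      have h2 := h1 ⟨0, by omega⟩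
      rw [FF_zero, FF_zero] at h2
      have h3 := h1 ⟨t + 1 + 1, by omega⟩
      rw [FF_last, FF_last, h2] at h3
      have h4 := Fin.succAbove_right_injective h3
      simp only [Fin.mk.injEq] at h2 h4
      have h5 : q = q' := Fin.ext (by omega)
      subst h5
      have h6 : p = p' := Fin.ext (by omega)
      rw [h6]
    · rintro ⟨π, hπ⟩
      obtain ⟨p, q, rfl⟩ := exists_FF π hπ
      have := (good_FF (by omega) p q).1 hπ
      refine ⟨⟨⟨q.val - 1, by omega⟩, ⟨p.val - 1, by simp only []; omega⟩⟩, ?_⟩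
      apply Subtype.ext
      simp only [G]
      congr 1
      · apply Fin.ext; simp only []; omega
      · apply Fin.ext; simp only []; omega
  rw [← Nat.card_congr (Equiv.ofBijective G hG), Nat.card_eq_fintype_card, Fintype.card_sigma]
  simp only [Fintype.card_fin]
  rw [Fin.sum_univ_eq_sum_range (fun q => q + 2) t]
  clear hG G
  induction t with
  | zero => simp
  | succ t ih => rw [Finset.sum_range_succ, mul_add, ih]; ring

/-- count of minimal `(k,3)`-bicrucial permutations: for `k ≥ 3`, the number `s`
of `(k,3)`-bicrucial permutations of the minimal length `k+1` satisfies
`2·s = (1+δ_{k,3})·(k+1)(k-2)`, i.e. `s = (1+δ_{k,3})(k+1)(k-2)/2`. -/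
theorem count_minimal_k3_bicrucial (k : ℕ) (hk : 3 ≤ k) :
    2 * Nat.card {σ : Equiv.Perm (Fin (k + 1)) // Bicrucial k 3 (k + 1) ⇑σ} =
      (1 + if k = 3 then 1 else 0) * (k + 1) * (k - 2) := by
  obtain rfl | hk' := eq_or_lt_of_le hk
  · rw [card3]; simp
  · obtain ⟨t, rfl⟩ : ∃ t, k = t + 2 := ⟨k - 2, by omega⟩
    have e : Nat.card {σ : Equiv.Perm (Fin (t + 2 + 1)) // Bicrucial (t + 2) 3 (t + 2 + 1) ⇑σ} =
        Nat.card {π : Equiv.Perm (Fin (t + 1 + 2)) // Good (t + 1) π} :=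
      Nat.card_congr (Equiv.subtypeEquiv (Equiv.inv (Equiv.Perm (Fin (t + 1 + 2))))
        (fun σ => bicrucial_iff_s12 (by omega) σ))
    rw [e, card_good, if_neg (by omega)]
    simp
end
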